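/- arXiv:2105.06273 — 2 statements merged into one kernel-verified Lean document; each statement's English description precedes it below -/
import Mathlib

section
/- Let A be an Artin algebra, D ⊆ mod A a 0-Igusa-Todorov subcategory, and C_1, C_2, E three subcategories of mod A such that for every E ∈ E there is an exact sequence 0 → C_1 → C_2 → E → 0 with C_i ∈ C_i for i = 1, 2. If C_1 and C_2 are D-syzygy finite, then E is (n, V, D)-LIT for some n ∈ ℕ and some V ∈ mod A; moreover one may take n = min{m : [Ω^m(C_1)]_D and [Ω^m(C_2)]_D are finitely generated}. -/
/-!
Common framework for formalizing "On Lat-Igusa-Todorov algebras" (Barrios–Mata).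

For a ring `S`, `FGMod S` is the "category" of finitely generated (left) `S`-modules;
for an Artin algebra `A`, the category `mod A` of finitely generated *right*
`A`-modules is `FGMod Aᵐᵒᵖ`.
-/

universe u v

open Function

namespace LIT

/-- The `η` invariant from Fitting's Lemma: for an endomorphism `L` of an abelian
group `G` and a subgroup `X`, the least `k` such that for all `m ≥ k` the
restriction of `L` to `L^m(X)` is a monomorphism `L^m(X) → L^{m+1}(X)`. -/
noncomputable def eta {G : Type v} [AddCommGroup G] (L : AddMonoid.End G)
    (X : AddSubgroup G) : ℕ :=
  sInf {k : ℕ | ∀ m : ℕ, k ≤ m → Set.InjOn L (X.map (L ^ m) : Set G)}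

/-- Bundled finitely generated `S`-modules. -/
structure FGMod (S : Type u) [Ring S] : Type (u + 1) where
  carrier : Type u
  [isAddCommGroup : AddCommGroup carrier]
  [isModule : Module S carrier]
  [isFinite : Module.Finite S carrier]

attribute [instance] FGMod.isAddCommGroup FGMod.isModule FGMod.isFinite

/-- The regular module `S` over itself. -/
def FGMod.regular (S : Type u) [Ring S] : FGMod S := ⟨S⟩

/-- A ring is finitely generated as a right module over itself. -/
instance (A : Type u) [Ring A] : Module.Finite Aᵐᵒᵖ A :=
  Module.Finite.of_surjective
    ({ toFun := MulOpposite.unop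
       map_add' := fun _ _ => rfl
       map_smul' := fun _ _ => rfl } : Aᵐᵒᵖ →ₗ[Aᵐᵒᵖ] A)
    (fun x => ⟨MulOpposite.op x, rfl⟩)

namespace FGMod

variable {S : Type u} [Ring S]

/-- Projectivity of a module. -/
def IsProj (M : FGMod S) : Prop := Module.Projective S M.carrier

/-- Direct sum (product) of two modules. -/
def prodMod (M N : FGMod S) : FGMod S := ⟨M.carrier × N.carrier⟩

/-- Finite direct sums. -/
def dsum {n : ℕ} (f : Fin n → FGMod S) : FGMod S := ⟨∀ i, (f i).carrier⟩

/-- `N` is a direct summand of `M`. -/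
def IsSummand (N M : FGMod S) : Prop :=
  ∃ N' : FGMod S, Nonempty (M.carrier ≃ₗ[S] N.carrier × N'.carrier)

/-- `addOf C` is `add C`: all direct summands of finite direct sums of modules of `C`. -/
def addOf (C : Set (FGMod S)) : Set (FGMod S) :=
  {N | ∃ (n : ℕ) (f : Fin n → FGMod S), (∀ i, f i ∈ C) ∧ IsSummand N (dsum f)}

/-- `f : P → M` is a projective cover: `P` projective, `f` surjective with superfluous kernel. -/
def IsProjCover {P M : FGMod S} (f : P.carrier →ₗ[S] M.carrier) : Prop :=
  P.IsProj ∧ Surjective f ∧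
    ∀ N : Submodule S P.carrier, N ⊔ LinearMap.ker f = ⊤ → N = ⊤

/-- `N` is (isomorphic to) the syzygy `Ω(M)`, i.e. the kernel of a projective cover of `M`. -/
def IsSyzygyOf (N M : FGMod S) : Prop :=
  ∃ (P : FGMod S) (f : P.carrier →ₗ[S] M.carrier),
    IsProjCover f ∧ Nonempty (N.carrier ≃ₗ[S] LinearMap.ker f)

/-- The syzygy `Ω(M)` of `M` (a choice of it; over an Artin algebra it exists and is
unique up to isomorphism). -/
noncomputable def syz (M : FGMod S) : FGMod S :=
  letI := Classical.propDecidable (∃ N, IsSyzygyOf N M)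
  if h : ∃ N, IsSyzygyOf N M then h.choose else M

/-- `SES X Y Z` : there is a short exact sequence `0 → X → Y → Z → 0`. -/
def SES (X Y Z : FGMod S) : Prop :=
  ∃ (f : X.carrier →ₗ[S] Y.carrier) (g : Y.carrier →ₗ[S] Z.carrier),
    Injective f ∧ Surjective g ∧ LinearMap.range f = LinearMap.ker g

/-- Projective dimension, via vanishing of syzygies. -/
noncomputable def pdim (M : FGMod S) : ℕ∞ :=
  sInf ((↑) '' {n : ℕ | (syz^[n] M).IsProj})

end FGMod

open FGMod

variable {S : Type u} [Ring S]

/-- The finitistic dimension of a class of modules: the supremum of the projective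
dimensions of its modules of finite projective dimension. -/
noncomputable def findim (C : Set (FGMod S)) : ℕ∞ :=
  ⨆ M ∈ {M ∈ C | pdim M ≠ ⊤}, pdim M

/-- The global dimension of a class of modules. -/
noncomputable def gldim (C : Set (FGMod S)) : ℕ∞ :=
  ⨆ M ∈ C, pdim M

/-- The defining relations of `K₀`: `[M] - [M'] - [M'']` for `M ≅ M' ⊕ M''`, and `[P]`
for `P` projective. -/
def K0Rels (S : Type u) [Ring S] : AddSubgroup (FreeAbelianGroup (FGMod S)) :=
  AddSubgroup.closure
    ({x | ∃ M M' M'' : FGMod S,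
        Nonempty (M.carrier ≃ₗ[S] M'.carrier × M''.carrier) ∧
        x = FreeAbelianGroup.of M - FreeAbelianGroup.of M' - FreeAbelianGroup.of M''} ∪
      {x | ∃ P : FGMod S, P.IsProj ∧ x = FreeAbelianGroup.of P})

/-- `K₀(A)`: the free abelian group on the modules modulo the relations above. -/
abbrev K0 (S : Type u) [Ring S] : Type (u + 1) :=
  FreeAbelianGroup (FGMod S) ⧸ K0Rels S

/-- The class `[M]` of a module in `K₀`. -/
def toK0 (M : FGMod S) : K0 S := QuotientAddGroup.mk (FreeAbelianGroup.of M)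

/-- `⟨C⟩`: the subgroup of `K₀` generated by the classes of direct summands of
modules of `C`. -/
def grpOf (C : Set (FGMod S)) : AddSubgroup (K0 S) :=
  AddSubgroup.closure {x | ∃ N M : FGMod S, M ∈ C ∧ IsSummand N M ∧ x = toK0 N}

/-- `K_D = K₀/⟨D⟩`. -/
abbrev KD (D : Set (FGMod S)) : Type (u + 1) := K0 S ⧸ grpOf D

/-- The class of a module in `K_D`. -/
def toKD (D : Set (FGMod S)) (M : FGMod S) : KD D :=
  QuotientAddGroup.mk (toK0 M)

/-- `L` is the endomorphism `Ω̄` of `K₀` induced by the syzygy operator (it is unique). -/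
def IsSyzEnd (L : AddMonoid.End (K0 S)) : Prop :=
  ∀ M : FGMod S, L (toK0 M) = toK0 (syz M)

/-- `L` is the endomorphism `Ω̄_D` of `K_D` induced by the syzygy operator. -/
def IsSyzEndD (D : Set (FGMod S)) (L : AddMonoid.End (KD D)) : Prop :=
  ∀ M : FGMod S, L (toKD D M) = toKD D (syz M)

/-- The Igusa–Todorov function `φ`, relative to the induced endomorphism `L = Ω̄` of `K₀`. -/
noncomputable def phi (L : AddMonoid.End (K0 S)) (M : FGMod S) : ℕ :=
  eta L (grpOf {M})

/-- `φ`-dimension of a class of modules. -/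
noncomputable def phidim (L : AddMonoid.End (K0 S)) (C : Set (FGMod S)) : ℕ∞ :=
  ⨆ M ∈ C, (phi L M : ℕ∞)

/-- The generalized Igusa–Todorov function `φ_[D]`, relative to `L = Ω̄_D`. -/
noncomputable def phiD (D : Set (FGMod S)) (L : AddMonoid.End (KD D)) (M : FGMod S) : ℕ :=
  eta L ((grpOf {M}).map (QuotientAddGroup.mk' (grpOf D)))

/-- The generalized Igusa–Todorov function `ψ_[D]`. -/
noncomputable def psiD (D : Set (FGMod S)) (L : AddMonoid.End (KD D)) (M : FGMod S) : ℕ∞ :=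
  (phiD D L M : ℕ∞) + findim (addOf {syz^[phiD D L M] M})

/-- `D` is a `0`-Igusa–Todorov subcategory: `D = add D`, `Ω(D) ⊆ D` and `φdim D = 0`. -/
def IsZeroIT (L : AddMonoid.End (K0 S)) (D : Set (FGMod S)) : Prop :=
  D = addOf D ∧ (∀ M ∈ D, syz M ∈ D) ∧ phidim L D = 0

/-- The class `C` is `(n,V,D)`-Lat-Igusa-Todorov: every `M ∈ C` admits an exact sequence
`0 → V₁ ⊕ D₁ → V₀ ⊕ D₀ → Ωⁿ(M) → 0` with `V₁, V₀ ∈ add V` and `D₁, D₀ ∈ D`. -/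
def IsLITClass (n : ℕ) (V : FGMod S) (D : Set (FGMod S)) (C : Set (FGMod S)) : Prop :=
  ∀ M ∈ C, ∃ V1 V0 D1 D0 : FGMod S,
    V1 ∈ addOf {V} ∧ V0 ∈ addOf {V} ∧ D1 ∈ D ∧ D0 ∈ D ∧
    SES (prodMod V1 D1) (prodMod V0 D0) (syz^[n] M)

/-- `[C]_D`: the image of `⟨C⟩` in `K_D`, i.e. `(⟨C⟩ + ⟨D⟩)/⟨D⟩`. -/
def classGrpD (D C : Set (FGMod S)) : AddSubgroup (KD D) :=
  (grpOf C).map (QuotientAddGroup.mk' (grpOf D))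

/-- `C` is `D`-syzygy finite: `[Ω^k(C)]_D` is finitely generated for some `k`. -/
def DSyzFinite (D C : Set (FGMod S)) : Prop :=
  ∃ k : ℕ, (classGrpD D ((fun M => syz^[k] M) '' C)).FG

/-- The algebra is `n`-LIT: there are a `0`-Igusa–Todorov subcategory `D` and a module `V`
such that `mod A` is `(n,V,D)`-LIT. -/
def IsNLITAlgebra (L : AddMonoid.End (K0 S)) (n : ℕ) : Prop :=
  ∃ (V : FGMod S) (D : Set (FGMod S)), IsZeroIT L D ∧ IsLITClass n V D Set.univ

/-- The algebra is LIT: it is `n`-LIT for some `n`. -/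
def IsLITAlgebra (L : AddMonoid.End (K0 S)) : Prop :=
  ∃ n : ℕ, IsNLITAlgebra L n

section Splitting

variable {I K M N W : Type u}
  [AddCommGroup I] [Module S I] [AddCommGroup K] [Module S K] [AddCommGroup M] [Module S M]
  [AddCommGroup N] [Module S N] [AddCommGroup W] [Module S W]

/-- A retraction `r` of `i` splits the ambient module as the source of `i` times `ker r`. -/
def splitEquiv (i : I →ₗ[S] W) (r : W →ₗ[S] I) (h : ∀ x, r (i x) = x) :
    W ≃ₗ[S] I × LinearMap.ker r where
  toFun w := (r w, ⟨w - i (r w), by simp [h]⟩)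
  map_add' x y := by
    ext
    · simp
    · simp only [map_add, Prod.snd_add, Submodule.coe_add]; abel
  map_smul' c x := by
    ext
    · simp
    · simp [smul_sub]
  invFun p := i p.1 + p.2
  left_inv w := by simp
  right_inv p := by
    have hp : r (p.2 : W) = 0 := p.2.2
    ext <;> simp [h, hp]

/-- The kernels of two retractions of the same map are isomorphic. -/
def kerEquivOfRetractions (i : I →ₗ[S] W) (r s : W →ₗ[S] I) (hr : ∀ x, r (i x) = x)
    (hs : ∀ x, s (i x) = x) : LinearMap.ker r ≃ₗ[S] LinearMap.ker s where
  toFun w := ⟨w - i (s w), by simp [hs]⟩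
  map_add' x y := by
    ext
    simp only [Submodule.coe_add, map_add]; abel
  map_smul' c x := by
    ext
    simp [smul_sub]
  invFun w := ⟨w - i (r w), by simp [hr]⟩
  left_inv w := by
    have hw : r (w : W) = 0 := w.2
    ext
    simp [hr, hw]
  right_inv w := by
    have hw : s (w : W) = 0 := w.2
    ext
    simp [hs, hw]

/-- The kernel of a map that factors through the first projection. -/
def kerCompFstEquiv (c : M →ₗ[S] I) :
    LinearMap.ker (c ∘ₗ LinearMap.fst S M N) ≃ₗ[S] LinearMap.ker c × N where
  toFun w := (⟨w.1.1, w.2⟩, w.1.2)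
  map_add' _ _ := rfl
  map_smul' _ _ := rfl
  invFun p := ⟨(p.1, p.2), p.1.2⟩
  left_inv _ := rfl
  right_inv _ := rfl

/-- The kernel of the first coordinate of an isomorphism onto a product. -/
def kerFstCompEquiv (e : W ≃ₗ[S] I × K) :
    LinearMap.ker (LinearMap.fst S I K ∘ₗ e.toLinearMap) ≃ₗ[S] K where
  toFun w := (e w).2
  map_add' _ _ := by simp
  map_smul' _ _ := by simp
  invFun k := ⟨e.symm (0, k), by simp⟩
  left_inv w := by
    have hw : (e (w : W)).1 = 0 := w.2
    ext
    simp only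
    rw [LinearEquiv.symm_apply_eq]
    ext <;> simp [hw]
  right_inv k := by simp

/-- The exchange property, when the component `I → M → I` of the identity is invertible. -/
theorem exchange_of_bijective (e : (I × K) ≃ₗ[S] (M × N))
    (h : Function.Bijective fun x : I => (e.symm ((e (x, 0)).1, 0)).1) :
    ∃ c : M →ₗ[S] I, Nonempty (M ≃ₗ[S] I × LinearMap.ker c) ∧
      Nonempty (K ≃ₗ[S] LinearMap.ker c × N) := by
  let a : I →ₗ[S] M := LinearMap.fst S M N ∘ₗ e.toLinearMap ∘ₗ LinearMap.inl S I K
  let b : M →ₗ[S] I := LinearMap.fst S I K ∘ₗ e.symm.toLinearMap ∘ₗ LinearMap.inl S M N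
  let u : I ≃ₗ[S] I := LinearEquiv.ofBijective (b ∘ₗ a) h
  let c : M →ₗ[S] I := u.symm.toLinearMap ∘ₗ b
  have hca : ∀ x, c (a x) = x := fun x => u.symm_apply_apply x
  refine ⟨c, ⟨splitEquiv a c hca⟩, ⟨?_⟩⟩
  exact (kerFstCompEquiv e.symm).symm.trans
    ((kerEquivOfRetractions (e.toLinearMap ∘ₗ LinearMap.inl S I K) _
      (c ∘ₗ LinearMap.fst S M N) (fun x => by simp) (fun x => hca x)).trans (kerCompFstEquiv c))

end Splitting

section IsoClasses

variable (S)

/-- Isomorphism of bundled modules. -/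
instance isoSetoid : Setoid (FGMod S) where
  r M N := Nonempty (M.carrier ≃ₗ[S] N.carrier)
  iseqv :=
    { refl := fun _ => ⟨LinearEquiv.refl _ _⟩
      symm := fun ⟨e⟩ => ⟨e.symm⟩
      trans := fun ⟨e⟩ ⟨f⟩ => ⟨e.trans f⟩ }

/-- Isomorphism classes of finitely generated modules. -/
def IsoCls : Type (u + 1) := Quotient (isoSetoid S)

variable {S}

/-- The isomorphism class of a module. -/
def cl (M : FGMod S) : IsoCls S := Quotient.mk _ M

theorem cl_eq_iff {M N : FGMod S} : cl M = cl N ↔ Nonempty (M.carrier ≃ₗ[S] N.carrier) :=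
  Quotient.eq

theorem exists_cl (x : IsoCls S) : ∃ M, cl M = x := Quotient.exists_rep x

instance : Zero (IsoCls S) := ⟨cl ⟨PUnit.{u + 1}⟩⟩

instance : Add (IsoCls S) :=
  ⟨Quotient.map₂ prodMod fun _ _ ⟨e⟩ _ _ ⟨f⟩ => ⟨e.prodCongr f⟩⟩

/-- Direct sum makes the isomorphism classes a commutative monoid. -/
instance : AddCommMonoid (IsoCls S) where
  add_assoc x y z := by
    obtain ⟨X, rfl⟩ := exists_cl x
    obtain ⟨Y, rfl⟩ := exists_cl y
    obtain ⟨Z, rfl⟩ := exists_cl z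
    exact Quotient.sound ⟨LinearEquiv.prodAssoc S X.carrier Y.carrier Z.carrier⟩
  zero_add x := by
    obtain ⟨X, rfl⟩ := exists_cl x
    exact Quotient.sound ⟨(LinearEquiv.uniqueProd : (PUnit.{u + 1} × X.carrier) ≃ₗ[S] X.carrier)⟩
  add_zero x := by
    obtain ⟨X, rfl⟩ := exists_cl x
    exact Quotient.sound ⟨(LinearEquiv.prodUnique : (X.carrier × PUnit.{u + 1}) ≃ₗ[S] X.carrier)⟩
  add_comm x y := by
    obtain ⟨X, rfl⟩ := exists_cl x
    obtain ⟨Y, rfl⟩ := exists_cl y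
    exact Quotient.sound ⟨LinearEquiv.prodComm S X.carrier Y.carrier⟩
  nsmul := nsmulRec

theorem cl_prodMod (M N : FGMod S) : cl (prodMod M N) = cl M + cl N := rfl

theorem cl_add_eq_iff {M N K : FGMod S} :
    cl M = cl N + cl K ↔ Nonempty (M.carrier ≃ₗ[S] N.carrier × K.carrier) :=
  cl_eq_iff (N := prodMod N K)

theorem cl_eq_zero_iff {M : FGMod S} : cl M = 0 ↔ Subsingleton M.carrier := by
  refine (cl_eq_iff (N := ⟨PUnit.{u + 1}⟩)).trans ⟨fun ⟨e⟩ => e.toEquiv.subsingleton, fun h => ?_⟩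
  exact ⟨{ toFun := fun _ => PUnit.unit
           map_add' := fun _ _ => rfl
           map_smul' := fun _ _ => rfl
           invFun := fun _ => 0
           left_inv := fun _ => Subsingleton.elim _ _
           right_inv := fun _ => rfl }⟩

theorem isSummand_iff {N M : FGMod S} : IsSummand N M ↔ ∃ x, cl M = cl N + x := by
  constructor
  · rintro ⟨N', h⟩
    exact ⟨cl N', cl_add_eq_iff.2 h⟩
  · rintro ⟨x, hx⟩
    obtain ⟨N', rfl⟩ := exists_cl x
    exact ⟨N', cl_add_eq_iff.1 hx⟩

theorem cl_dsum {n : ℕ} (f : Fin n → FGMod S) : cl (dsum f) = ∑ i, cl (f i) := by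
  induction n with
  | zero =>
    rw [Fin.sum_univ_zero, cl_eq_zero_iff]
    exact inferInstanceAs (Subsingleton (∀ i : Fin 0, (f i).carrier))
  | succ n ih =>
    rw [Fin.sum_univ_succ, ← ih, cl_add_eq_iff]
    exact ⟨(Fin.consLinearEquiv S fun i => (f i).carrier).symm⟩

variable [IsArtinianRing S]

/-- The length of an isomorphism class. -/
noncomputable def len : IsoCls S →+ ℕ where
  toFun := Quotient.lift (fun M => (Module.length S M.carrier).toNat)
    fun _ _ ⟨e⟩ => by simp only [e.length_eq]
  map_zero' := by
    change (Module.length S PUnit.{u + 1}).toNat = 0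
    simp [Module.length_eq_zero]
  map_add' x y := by
    obtain ⟨X, rfl⟩ := exists_cl x
    obtain ⟨Y, rfl⟩ := exists_cl y
    change (Module.length S (X.carrier × Y.carrier)).toNat = _
    rw [Module.length_prod, ENat.toNat_add Module.length_ne_top Module.length_ne_top]
    rfl

theorem len_cl (M : FGMod S) : len (cl M) = (Module.length S M.carrier).toNat := rfl

theorem len_eq_zero {x : IsoCls S} : len x = 0 ↔ x = 0 := by
  obtain ⟨X, rfl⟩ := exists_cl x
  rw [len_cl, cl_eq_zero_iff, ENat.toNat_eq_zero, ← Module.length_eq_zero_iff (R := S)]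
  simp [Module.length_ne_top]

theorem len_pos {x : IsoCls S} (h : x ≠ 0) : 0 < len x :=
  Nat.pos_of_ne_zero fun h0 => h (len_eq_zero.1 h0)

theorem add_eq_zero_left {x y : IsoCls S} (h : x + y = 0) : x = 0 := by
  have := congrArg len h
  rw [map_add, map_zero] at this
  exact len_eq_zero.1 (by omega)

/-- Indecomposable isomorphism classes. -/
def Indec (x : IsoCls S) : Prop := x ≠ 0 ∧ ∀ y z, x = y + z → y = 0 ∨ z = 0

theorem exists_indec_summand (n : ℕ) :
    ∀ x : IsoCls S, len x ≤ n → x ≠ 0 → ∃ i y, Indec i ∧ x = i + y := by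
  induction n with
  | zero => exact fun x hx h => absurd (len_eq_zero.1 (by omega)) h
  | succ n ih =>
    intro x hx h
    by_cases hi : Indec x
    · exact ⟨x, 0, hi, (add_zero x).symm⟩
    · have hd := hi
      simp only [Indec, not_and, not_forall, not_or] at hd
      obtain ⟨y, z, rfl, hy, hz⟩ := hd h
      have := len_pos hz
      rw [map_add] at hx
      obtain ⟨i, w, hw, rfl⟩ := ih y (by omega) hy
      exact ⟨i, w + z, hw, add_assoc _ _ _⟩

theorem indec_induction {P : IsoCls S → Prop} (zero : P 0)
    (add : ∀ i x, Indec i → P x → P (i + x)) (x : IsoCls S) : P x := by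
  induction hn : len x using Nat.strong_induction_on generalizing x with
  | _ n ih =>
    by_cases hx : x = 0
    · exact hx ▸ zero
    · obtain ⟨i, y, hi, rfl⟩ := exists_indec_summand _ x le_rfl hx
      have := len_pos hi.1
      rw [map_add] at hn
      exact add i y hi (ih _ (by omega) y rfl)

/-- Fitting's lemma: in an indecomposable module one of two endomorphisms with sum the identity
is bijective. -/
theorem bijective_or_of_indec {M : FGMod S} (h : Indec (cl M))
    (f g : Module.End S M.carrier) (hfg : f + g = 1) :
    Function.Bijective f ∨ Function.Bijective g := by
  obtain ⟨n, hn, hn1⟩ := (f.eventually_isCompl_ker_pow_range_pow.and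
    (Filter.eventually_ge_atTop 1)).exists
  have key := h.2 (cl ⟨LinearMap.ker (f ^ n)⟩) (cl ⟨LinearMap.range (f ^ n)⟩)
    (cl_add_eq_iff.2 ⟨(Submodule.prodEquivOfIsCompl _ _ hn).symm⟩)
  simp only [cl_eq_zero_iff, Submodule.subsingleton_iff_eq_bot] at key
  rcases key with hk | hr
  · refine Or.inl (IsArtinian.bijective_of_injective_endomorphism f ?_)
    rw [← LinearMap.ker_eq_bot, eq_bot_iff, ← hk]
    obtain ⟨m, rfl⟩ := Nat.exists_eq_add_of_le' hn1
    intro x hx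
    rw [LinearMap.mem_ker] at hx ⊢
    rw [pow_succ, Module.End.mul_apply, hx, map_zero]
  · refine Or.inr ?_
    rw [← Module.End.isUnit_iff, eq_sub_of_add_eq' hfg]
    exact IsNilpotent.isUnit_one_sub ⟨n, LinearMap.range_eq_bot.1 hr⟩

theorem exchange {i k m n : IsoCls S} (hi : Indec i) (h : i + k = m + n) :
    (∃ m', m = i + m' ∧ k = m' + n) ∨ (∃ n', n = i + n' ∧ k = m + n') := by
  obtain ⟨I, rfl⟩ := exists_cl i
  obtain ⟨K, rfl⟩ := exists_cl k
  obtain ⟨M, rfl⟩ := exists_cl m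
  obtain ⟨N, rfl⟩ := exists_cl n
  obtain ⟨e⟩ : Nonempty ((I.carrier × K.carrier) ≃ₗ[S] (M.carrier × N.carrier)) :=
    cl_eq_iff.1 h
  let f : Module.End S I.carrier := LinearMap.fst S _ _ ∘ₗ e.symm.toLinearMap ∘ₗ
    LinearMap.inl S _ _ ∘ₗ LinearMap.fst S _ _ ∘ₗ e.toLinearMap ∘ₗ LinearMap.inl S _ _
  let g : Module.End S I.carrier := LinearMap.fst S _ _ ∘ₗ e.symm.toLinearMap ∘ₗ
    LinearMap.inr S _ _ ∘ₗ LinearMap.snd S _ _ ∘ₗ e.toLinearMap ∘ₗ LinearMap.inl S _ _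
  have hfg : f + g = 1 := by
    ext x
    change (e.symm ((e (x, 0)).1, 0)).1 + (e.symm (0, (e (x, 0)).2)).1 = x
    rw [← Prod.fst_add, ← map_add]
    simp
  rcases bijective_or_of_indec hi f g hfg with hf | hg
  · obtain ⟨c, h1, h2⟩ := exchange_of_bijective e hf
    exact Or.inl ⟨cl ⟨LinearMap.ker c⟩, cl_add_eq_iff.2 h1, cl_add_eq_iff.2 h2⟩
  · obtain ⟨c, h1, h2⟩ := exchange_of_bijective (e.trans (LinearEquiv.prodComm S _ _)) hg
    exact Or.inr ⟨cl ⟨LinearMap.ker c⟩, cl_add_eq_iff.2 h1,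
      (cl_add_eq_iff.2 h2).trans (add_comm _ _)⟩

theorem indec_add_cancel {i k n : IsoCls S} (hi : Indec i) (h : i + k = i + n) : k = n := by
  rcases exchange hi h with ⟨m', hm, rfl⟩ | ⟨n', rfl, rfl⟩
  · have := congrArg len hm
    rw [map_add] at this
    rw [len_eq_zero.1 (show len m' = 0 by omega), zero_add]
  · rfl

instance : IsCancelAdd (IsoCls S) :=
  have : IsLeftCancelAdd (IsoCls S) := ⟨fun z => by
    induction z using indec_induction with
    | zero => intro x y h; simpa using h
    | add i z hi ih =>
      intro x y h
      simp only [add_assoc] at h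
      exact ih (indec_add_cancel hi h)⟩
  AddCommMagma.IsLeftCancelAdd.toIsCancelAdd _

/-- The Riesz refinement property of isomorphism classes. -/
theorem refinement (a : IsoCls S) : ∀ b c d : IsoCls S, a + b = c + d →
    ∃ c₁ c₂ d₁ d₂, a = c₁ + d₁ ∧ b = c₂ + d₂ ∧ c = c₁ + c₂ ∧ d = d₁ + d₂ := by
  induction a using indec_induction with
  | zero => exact fun b c d h => ⟨0, c, 0, d, by simp, by simpa using h, by simp, by simp⟩
  | add i a hi ih =>
    intro b c d h
    rw [add_assoc] at h
    rcases exchange hi h with ⟨c', rfl, h'⟩ | ⟨d', rfl, h'⟩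
    · obtain ⟨c₁, c₂, d₁, d₂, rfl, rfl, rfl, rfl⟩ := ih _ _ _ h'
      exact ⟨i + c₁, c₂, d₁, d₂, by abel, rfl, by abel, rfl⟩
    · obtain ⟨c₁, c₂, d₁, d₂, rfl, rfl, rfl, rfl⟩ := ih _ _ _ h'
      exact ⟨c₁, c₂, i + d₁, d₂, by abel, rfl, rfl, by abel⟩

end IsoClasses

section FinitelyGenerated

variable {G : Type*} [AddCommGroup G]

theorem addSubgroup_fg_of_le {H K : AddSubgroup G} (hK : K.FG) (h : H ≤ K) : H.FG := by
  have hK' : (AddSubgroup.toIntSubmodule K).FG := (Submodule.fg_iff_addSubgroup_fg _).2 hK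
  exact (Submodule.fg_iff_addSubgroup_fg _).1
    (hK'.of_le (S := AddSubgroup.toIntSubmodule H) (AddSubgroup.toIntSubmodule.monotone h))

theorem addSubgroup_fg_closure_singleton (x : G) : (AddSubgroup.closure {x}).FG :=
  ⟨{x}, by rw [Finset.coe_singleton]⟩

/-- The image of `H` in `G ⧸ N` is finitely generated if and only if `H` is contained in
`F + N` for a finitely generated subgroup `F`. -/
theorem addSubgroup_map_mk_fg_iff {H N : AddSubgroup G} :
    (H.map (QuotientAddGroup.mk' N)).FG ↔ ∃ F : AddSubgroup G, F.FG ∧ H ≤ F ⊔ N := by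
  classical
  constructor
  · rintro ⟨T, hT⟩
    have hmap : (AddSubgroup.closure ((T.image Quotient.out : Finset G) : Set G)).map
        (QuotientAddGroup.mk' N) = H.map (QuotientAddGroup.mk' N) := by
      rw [AddMonoidHom.map_closure, ← hT, Finset.coe_image, Set.image_image]
      congr 1
      exact (Set.image_congr fun q _ => Quotient.out_eq q).trans (Set.image_id' _)
    refine ⟨_, ⟨T.image Quotient.out, rfl⟩, fun x hx => ?_⟩
    obtain ⟨y, hy, hxy⟩ := hmap.ge (AddSubgroup.mem_map_of_mem _ hx)
    rw [← add_neg_cancel_left y x]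
    exact add_mem (AddSubgroup.mem_sup_left hy)
      (AddSubgroup.mem_sup_right (QuotientAddGroup.eq.1 hxy))
  · rintro ⟨F, ⟨T, rfl⟩, hF⟩
    refine addSubgroup_fg_of_le (K := (AddSubgroup.closure (T : Set G)).map
      (QuotientAddGroup.mk' N)) ⟨T.image (QuotientAddGroup.mk' N), ?_⟩
      ((AddSubgroup.map_mono hF).trans ?_)
    · rw [AddMonoidHom.map_closure, Finset.coe_image]
    · rw [AddSubgroup.map_sup]
      refine sup_le le_rfl ?_
      rw [(AddSubgroup.map_eq_bot_iff _).2 (QuotientAddGroup.ker_mk' N).ge]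
      exact bot_le

end FinitelyGenerated

section GrothendieckGroup

theorem toK0_prodMod (M N : FGMod S) : toK0 (prodMod M N) = toK0 M + toK0 N := by
  have h : toK0 (prodMod M N) - toK0 M - toK0 N = 0 :=
    (QuotientAddGroup.eq_zero_iff _).2 <| AddSubgroup.subset_closure <|
      Or.inl ⟨prodMod M N, M, N, ⟨LinearEquiv.refl _ _⟩, rfl⟩
  rw [sub_sub, sub_eq_zero] at h
  exact h

theorem toK0_of_isProj {P : FGMod S} (hP : P.IsProj) : toK0 P = 0 :=
  (QuotientAddGroup.eq_zero_iff _).2 <| AddSubgroup.subset_closure <| Or.inr ⟨P, hP, rfl⟩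

theorem toK0_eq_of_equiv {M N : FGMod S} (h : Nonempty (M.carrier ≃ₗ[S] N.carrier)) :
    toK0 M = toK0 N := by
  have hz : FGMod.IsProj (⟨PUnit.{u + 1}⟩ : FGMod S) :=
    inferInstanceAs (Module.Projective S PUnit.{u + 1})
  have h0 : toK0 M - toK0 N - toK0 (⟨PUnit.{u + 1}⟩ : FGMod S) = 0 :=
    (QuotientAddGroup.eq_zero_iff _).2 <| AddSubgroup.subset_closure <|
      Or.inl ⟨M, N, _, h.map fun e => e.trans LinearEquiv.prodUnique.symm, rfl⟩
  rwa [toK0_of_isProj hz, sub_zero, sub_eq_zero] at h0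

/-- The class in `K₀` of an isomorphism class. -/
noncomputable def k0 : IsoCls S →+ K0 S where
  toFun := Quotient.lift toK0 fun _ _ h => toK0_eq_of_equiv h
  map_zero' := toK0_of_isProj (P := ⟨PUnit.{u + 1}⟩)
    (inferInstanceAs (Module.Projective S PUnit.{u + 1}))
  map_add' x y := by
    obtain ⟨X, rfl⟩ := exists_cl x
    obtain ⟨Y, rfl⟩ := exists_cl y
    exact toK0_prodMod X Y

theorem k0_cl (M : FGMod S) : k0 (cl M) = toK0 M := rfl

theorem exists_toK0_sub_toK0 (x : K0 S) : ∃ M N : FGMod S, x = toK0 M - toK0 N := by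
  obtain ⟨x, rfl⟩ := QuotientAddGroup.mk_surjective x
  have h0 : toK0 (⟨PUnit.{u + 1}⟩ : FGMod S) = 0 := k0.map_zero
  induction x using FreeAbelianGroup.induction_on with
  | zero => exact ⟨⟨PUnit.{u + 1}⟩, ⟨PUnit.{u + 1}⟩, by simp⟩
  | of M => exact ⟨M, ⟨PUnit.{u + 1}⟩, by rw [h0, sub_zero]; rfl⟩
  | neg M => exact ⟨⟨PUnit.{u + 1}⟩, M, by rw [h0, zero_sub]; rfl⟩
  | add x y hx hy =>
    obtain ⟨M, N, h⟩ := hx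
    obtain ⟨M', N', h'⟩ := hy
    refine ⟨prodMod M M', prodMod N N', ?_⟩
    rw [QuotientAddGroup.mk_add, h, h', toK0_prodMod, toK0_prodMod]
    abel

theorem isProj_prodMod {P Q : FGMod S} (hP : P.IsProj) (hQ : Q.IsProj) : (prodMod P Q).IsProj := by
  have : Module.Projective S P.carrier := hP
  have : Module.Projective S Q.carrier := hQ
  exact inferInstanceAs (Module.Projective S (P.carrier × Q.carrier))

theorem lift_mem_of_mem_K0Rels {x : FreeAbelianGroup (FGMod S)} (hx : x ∈ K0Rels S) :
    ∃ P Q : FGMod S, P.IsProj ∧ Q.IsProj ∧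
      FreeAbelianGroup.lift (fun M => Algebra.GrothendieckAddGroup.of (cl M)) x =
        Algebra.GrothendieckAddGroup.of (cl P) - Algebra.GrothendieckAddGroup.of (cl Q) := by
  have hz : FGMod.IsProj (⟨PUnit.{u + 1}⟩ : FGMod S) :=
    inferInstanceAs (Module.Projective S PUnit.{u + 1})
  have h0 : cl (⟨PUnit.{u + 1}⟩ : FGMod S) = 0 := rfl
  induction hx using AddSubgroup.closure_induction with
  | mem x hx =>
    rcases hx with ⟨M, M', M'', h, rfl⟩ | ⟨P, hP, rfl⟩
    · refine ⟨⟨PUnit.{u + 1}⟩, ⟨PUnit.{u + 1}⟩, hz, hz, ?_⟩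
      simp [cl_add_eq_iff.2 h]
    · exact ⟨P, ⟨PUnit.{u + 1}⟩, hP, hz, by simp [h0]⟩
  | zero => exact ⟨⟨PUnit.{u + 1}⟩, ⟨PUnit.{u + 1}⟩, hz, hz, by simp⟩
  | add x y _ _ hx hy =>
    obtain ⟨P, Q, hP, hQ, h⟩ := hx
    obtain ⟨P', Q', hP', hQ', h'⟩ := hy
    refine ⟨prodMod P P', prodMod Q Q', isProj_prodMod hP hP', isProj_prodMod hQ hQ', ?_⟩
    rw [map_add, h, h', cl_prodMod, cl_prodMod, map_add, map_add]
    abel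
  | neg x _ hx =>
    obtain ⟨P, Q, hP, hQ, h⟩ := hx
    exact ⟨Q, P, hQ, hP, by rw [map_neg, h, neg_sub]⟩

/-- The isomorphism classes of the modules in `add C`. -/
def sp (C : Set (FGMod S)) : AddSubmonoid (IsoCls S) where
  carrier := {x | ∃ y, x + y ∈ AddSubmonoid.closure (cl '' C)}
  zero_mem' := ⟨0, by simp⟩
  add_mem' := by
    rintro a b ⟨a', ha⟩ ⟨b', hb⟩
    exact ⟨a' + b', by simpa only [add_add_add_comm] using add_mem ha hb⟩

theorem mem_sp_of_add {C : Set (FGMod S)} {x y : IsoCls S} (h : x + y ∈ sp C) : x ∈ sp C := by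
  obtain ⟨z, hz⟩ := h
  exact ⟨y + z, by rwa [← add_assoc]⟩

theorem closure_le_sp (C : Set (FGMod S)) : AddSubmonoid.closure (cl '' C) ≤ sp C :=
  fun x hx => ⟨0, by rwa [add_zero]⟩

theorem cl_mem_sp {C : Set (FGMod S)} {M : FGMod S} (h : M ∈ C) : cl M ∈ sp C :=
  closure_le_sp C (AddSubmonoid.subset_closure ⟨M, h, rfl⟩)

theorem mem_addOf_iff {C : Set (FGMod S)} {N : FGMod S} : N ∈ addOf C ↔ cl N ∈ sp C := by
  constructor
  · rintro ⟨n, f, hf, hN⟩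
    obtain ⟨x, hx⟩ := isSummand_iff.1 hN
    rw [cl_dsum] at hx
    exact mem_sp_of_add (hx ▸ sum_mem fun i _ => cl_mem_sp (hf i))
  · rintro ⟨x, hx⟩
    obtain ⟨l, hl, hs⟩ := AddSubmonoid.exists_list_of_mem_closure hx
    choose f hf hfl using fun i : Fin l.length => hl l[i] (List.getElem_mem _)
    refine ⟨l.length, f, hf, isSummand_iff.2 ⟨x, ?_⟩⟩
    rw [cl_dsum, ← hs, Finset.sum_congr rfl fun i _ => hfl i]
    exact Fin.sum_univ_getElem l

theorem exists_add_of_mem_grpOf {C : Set (FGMod S)} {g : K0 S} (hg : g ∈ grpOf C) :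
    ∃ w ∈ sp C, ∃ w' ∈ sp C, g + k0 w = k0 w' := by
  induction hg using AddSubgroup.closure_induction with
  | mem g hg =>
    obtain ⟨N, M, hM, hN, rfl⟩ := hg
    obtain ⟨y, hy⟩ := isSummand_iff.1 hN
    exact ⟨0, zero_mem _, cl N, mem_sp_of_add (hy ▸ cl_mem_sp hM), by simp [k0_cl]⟩
  | zero => exact ⟨0, zero_mem _, 0, zero_mem _, by simp⟩
  | add g h _ _ hg hh =>
    obtain ⟨w, hw, w', hw', e⟩ := hg
    obtain ⟨v, hv, v', hv', e'⟩ := hh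
    exact ⟨w + v, add_mem hw hv, w' + v', add_mem hw' hv', by
      rw [map_add, map_add, ← e, ← e']; abel⟩
  | neg g _ hg =>
    obtain ⟨w, hw, w', hw', e⟩ := hg
    exact ⟨w', hw', w, hw, by rw [← e]; abel⟩

variable [IsArtinianRing S]

/-- Modules with the same class in `K₀` are isomorphic up to projective summands. -/
theorem exists_proj_of_k0_eq {x y : IsoCls S} (h : k0 x = k0 y) :
    ∃ P Q : FGMod S, P.IsProj ∧ Q.IsProj ∧ x + cl P = y + cl Q := by
  obtain ⟨M, rfl⟩ := exists_cl x
  obtain ⟨N, rfl⟩ := exists_cl y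
  obtain ⟨P, Q, hP, hQ, hPQ⟩ := lift_mem_of_mem_K0Rels (QuotientAddGroup.eq.1 h)
  refine ⟨P, Q, hP, hQ, Algebra.GrothendieckAddGroup.of_injective ?_⟩
  rw [map_add, map_neg, FreeAbelianGroup.lift_apply_of, FreeAbelianGroup.lift_apply_of] at hPQ
  rw [map_add, map_add, ← sub_eq_zero, ← sub_eq_zero.2 hPQ.symm]
  abel

/-- Membership of the class of every summand can be tested on generators. -/
theorem forall_summand_mem {C : Set (FGMod S)} {G : AddSubgroup (K0 S)}
    (h : ∀ M ∈ C, ∀ x y, cl M = x + y → k0 x ∈ G) {x : IsoCls S} (hx : x ∈ sp C) : k0 x ∈ G := by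
  obtain ⟨y, hy⟩ := hx
  generalize hw : x + y = w at hy
  induction hy using AddSubmonoid.closure_induction generalizing x y with
  | mem w hw' =>
    obtain ⟨M, hM, rfl⟩ := hw'
    exact h M hM x y hw.symm
  | zero =>
    rw [add_eq_zero_left hw, map_zero]
    exact G.zero_mem
  | add v w _ _ hv hw' =>
    obtain ⟨c₁, c₂, d₁, d₂, rfl, rfl, rfl, rfl⟩ := refinement _ _ _ _ hw
    rw [map_add]
    exact G.add_mem (hv _ rfl) (hw' _ rfl)

theorem k0_mem_grpOf {C : Set (FGMod S)} {x : IsoCls S} (hx : x ∈ sp C) : k0 x ∈ grpOf C := by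
  refine forall_summand_mem (fun M hM x y h => AddSubgroup.subset_closure ?_) hx
  obtain ⟨X, rfl⟩ := exists_cl x
  exact ⟨X, M, hM, isSummand_iff.2 ⟨y, h⟩, rfl⟩

theorem grpOf_le_iff {C : Set (FGMod S)} {G : AddSubgroup (K0 S)} :
    grpOf C ≤ G ↔ ∀ M ∈ C, ∀ x y, cl M = x + y → k0 x ∈ G := by
  constructor
  · exact fun h M hM x y hxy => h (k0_mem_grpOf (mem_sp_of_add (hxy ▸ cl_mem_sp hM)))
  · intro h
    refine (AddSubgroup.closure_le G).2 ?_
    rintro _ ⟨N, M, hM, hN, rfl⟩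
    obtain ⟨y, hy⟩ := isSummand_iff.1 hN
    exact h M hM _ y hy

theorem grpOf_le_grpOf {C C' : Set (FGMod S)} (h : ∀ M ∈ C, cl M ∈ sp C') :
    grpOf C ≤ grpOf C' :=
  grpOf_le_iff.2 fun M hM _ _ hxy => k0_mem_grpOf (mem_sp_of_add (hxy ▸ h M hM))

theorem cl_mem_sp_of_isProj {C : Set (FGMod S)} (hC : cl (regular S) ∈ sp C) {P : FGMod S}
    (hP : P.IsProj) : cl P ∈ sp C := by
  have : Module.Projective S P.carrier := hP
  obtain ⟨n, f, hf⟩ := Module.Finite.exists_fin' S P.carrier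
  obtain ⟨s, hs⟩ := Module.projective_lifting_property f LinearMap.id hf
  have h : cl (dsum fun _ : Fin n => regular S) = cl P + cl ⟨LinearMap.ker f⟩ :=
    cl_add_eq_iff.2 ⟨splitEquiv s f fun x => LinearMap.congr_fun hs x⟩
  rw [cl_dsum] at h
  exact mem_sp_of_add (h ▸ sum_mem fun _ _ => hC)

/-- Membership in `add C` is detected in `K₀` as soon as `add C` contains the projectives. -/
theorem mem_sp_of_k0_mem {C : Set (FGMod S)} (hC : cl (regular S) ∈ sp C) {x : IsoCls S}
    (hx : k0 x ∈ grpOf C) : x ∈ sp C := by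
  obtain ⟨w, hw, w', hw', e⟩ := exists_add_of_mem_grpOf hx
  rw [← map_add] at e
  obtain ⟨P, Q, hP, hQ, h⟩ := exists_proj_of_k0_eq e
  rw [add_assoc] at h
  exact mem_sp_of_add (h ▸ add_mem hw' (cl_mem_sp_of_isProj hC hQ))

theorem exists_add_of_mem_sp_union {C C' : Set (FGMod S)} {x : IsoCls S} (hx : x ∈ sp (C ∪ C')) :
    ∃ v ∈ sp C, ∃ d ∈ sp C', x = v + d := by
  obtain ⟨y, hy⟩ := hx
  rw [Set.image_union, AddSubmonoid.closure_union] at hy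
  obtain ⟨t, ht, t', ht', h⟩ := AddSubmonoid.mem_sup.1 hy
  obtain ⟨c₁, c₂, d₁, d₂, rfl, rfl, rfl, rfl⟩ := refinement _ _ _ _ h.symm
  exact ⟨c₁, ⟨_, ht⟩, d₁, ⟨_, ht'⟩, rfl⟩

theorem grpOf_union (C C' : Set (FGMod S)) : grpOf (C ∪ C') = grpOf C ⊔ grpOf C' := by
  apply le_antisymm
  · refine grpOf_le_iff.2 ?_
    rintro M (hM | hM) x y hxy
    · exact AddSubgroup.mem_sup_left (k0_mem_grpOf (mem_sp_of_add (hxy ▸ cl_mem_sp hM)))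
    · exact AddSubgroup.mem_sup_right (k0_mem_grpOf (mem_sp_of_add (hxy ▸ cl_mem_sp hM)))
  · exact sup_le (grpOf_le_grpOf fun M hM => cl_mem_sp (Or.inl hM))
      (grpOf_le_grpOf fun M hM => cl_mem_sp (Or.inr hM))

theorem grpOf_singleton_fg (W : FGMod S) : (grpOf {W}).FG := by
  suffices h : ∀ w : IsoCls S, ∃ G : AddSubgroup (K0 S), G.FG ∧ ∀ x y, w = x + y → k0 x ∈ G by
    obtain ⟨G, hG, h⟩ := h (cl W)
    refine addSubgroup_fg_of_le hG (grpOf_le_iff.2 ?_)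
    rintro _ rfl
    exact h
  intro w
  induction w using indec_induction with
  | zero =>
    refine ⟨⊥, AddSubgroup.FG.bot, fun x y h => ?_⟩
    rw [add_eq_zero_left h.symm, map_zero]
    exact zero_mem _
  | add i w hi ih =>
    obtain ⟨G, hG, h⟩ := ih
    refine ⟨AddSubgroup.closure {k0 i} ⊔ G, ?_, fun x y hxy => ?_⟩
    · exact AddSubgroup.FG.sup (addSubgroup_fg_closure_singleton _) hG
    · obtain ⟨c₁, c₂, d₁, d₂, rfl, rfl, rfl, rfl⟩ := refinement _ _ _ _ hxy
      rw [map_add k0 c₁ c₂]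
      refine add_mem (AddSubgroup.mem_sup_left ?_) (AddSubgroup.mem_sup_right (h _ _ rfl))
      rcases hi.2 _ _ rfl with rfl | rfl
      · simp
      · rw [add_zero]
        exact AddSubgroup.subset_closure rfl

theorem exists_le_grpOf_of_fg {G : AddSubgroup (K0 S)} (hG : G.FG) :
    ∃ V : FGMod S, G ≤ grpOf {V} := by
  classical
  obtain ⟨T, rfl⟩ := hG
  induction T using Finset.induction_on with
  | empty => exact ⟨regular S, by simp⟩
  | insert x T _ ih =>
    obtain ⟨V, hV⟩ := ih
    obtain ⟨M, N, rfl⟩ := exists_toK0_sub_toK0 x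
    have hs : cl (prodMod V (prodMod M N)) ∈ sp {prodMod V (prodMod M N)} := cl_mem_sp rfl
    rw [cl_prodMod, cl_prodMod] at hs
    refine ⟨prodMod V (prodMod M N), (AddSubgroup.closure_le _).2 ?_⟩
    rw [Finset.coe_insert, Set.insert_subset_iff]
    refine ⟨sub_mem (k0_mem_grpOf (x := cl M) (mem_sp_of_add (y := cl V + cl N) ?_))
      (k0_mem_grpOf (x := cl N) (mem_sp_of_add (y := cl V + cl M) ?_)), ?_⟩
    · convert hs using 1; abel
    · convert hs using 1; abel
    · refine AddSubgroup.subset_closure.trans (hV.trans (grpOf_le_grpOf ?_))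
      rintro _ rfl
      exact mem_sp_of_add hs

/-- `[C]_D` is finitely generated if and only if `⟨C⟩` is contained in `⟨V⟩ + ⟨D⟩` for a
module `V`. -/
theorem classGrpD_fg_iff {C D : Set (FGMod S)} :
    (classGrpD D C).FG ↔ ∃ V : FGMod S, grpOf C ≤ grpOf ({V} ∪ D) := by
  simp only [grpOf_union]
  refine addSubgroup_map_mk_fg_iff.trans ⟨?_, fun ⟨V, hV⟩ => ⟨_, grpOf_singleton_fg V, hV⟩⟩
  rintro ⟨F, hF, h⟩
  obtain ⟨V, hV⟩ := exists_le_grpOf_of_fg hF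
  exact ⟨V, h.trans (sup_le_sup_right hV _)⟩

end GrothendieckGroup

section Syzygies

theorem ses_congr {X X' Y Y' Z Z' : FGMod S} (h : SES X Y Z) (hX : cl X = cl X')
    (hY : cl Y = cl Y') (hZ : cl Z = cl Z') : SES X' Y' Z' := by
  obtain ⟨eX⟩ := cl_eq_iff.1 hX
  obtain ⟨eY⟩ := cl_eq_iff.1 hY
  obtain ⟨eZ⟩ := cl_eq_iff.1 hZ
  obtain ⟨f, g, hf, hg, hfg⟩ := h
  refine ⟨eY.toLinearMap ∘ₗ f ∘ₗ eX.symm.toLinearMap, eZ.toLinearMap ∘ₗ g ∘ₗ eY.symm.toLinearMap,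
    ?_, ?_, ?_⟩
  · exact eY.injective.comp (hf.comp eX.symm.injective)
  · exact eZ.surjective.comp (hg.comp eY.symm.surjective)
  · ext y
    have h := SetLike.ext_iff.1 hfg (eY.symm y)
    rw [LinearMap.mem_range, LinearMap.mem_ker] at h ⊢
    simp only [LinearMap.comp_apply, LinearEquiv.coe_coe, LinearEquiv.map_eq_zero_iff, ← h]
    constructor
    · rintro ⟨x, rfl⟩
      exact ⟨eX.symm x, by simp⟩
    · rintro ⟨x, hx⟩
      exact ⟨eX x, by simp [hx]⟩

variable [IsArtinianRing S]

theorem exists_projective_cover (M : FGMod S) :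
    ∃ (P : FGMod S) (f : P.carrier →ₗ[S] M.carrier), IsProjCover f := by
  have hne : ∃ (n : ℕ) (P : FGMod S) (f : P.carrier →ₗ[S] M.carrier),
      P.IsProj ∧ Surjective f ∧ len (cl P) = n := by
    obtain ⟨k, f, hf⟩ := Module.Finite.exists_fin' S M.carrier
    exact ⟨_, dsum fun _ : Fin k => regular S, f,
      inferInstanceAs (Module.Projective S (Fin k → S)), hf, rfl⟩
  classical
  obtain ⟨P, f, hP, hf, hn⟩ := Nat.find_spec hne
  refine ⟨P, f, hP, hf, fun N hN => ?_⟩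
  have : Module.Projective S P.carrier := hP
  have hfN : Surjective (f ∘ₗ N.subtype) := by
    intro m
    obtain ⟨p, rfl⟩ := hf m
    obtain ⟨x, hx, y, hy, rfl⟩ := Submodule.mem_sup.1 (hN ▸ Submodule.mem_top (x := p))
    exact ⟨⟨x, hx⟩, by simp [LinearMap.mem_ker.1 hy]⟩
  obtain ⟨h, hh⟩ := Module.projective_lifting_property (f ∘ₗ N.subtype) f hfN
  let e : Module.End S P.carrier := N.subtype ∘ₗ h
  have he : ∀ p, f (e p) = f p := fun p => LinearMap.congr_fun hh p
  have hpow : ∀ (n : ℕ) p, f ((e ^ n) p) = f p := by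
    intro n
    induction n with
    | zero => simp
    | succ n ih => exact fun p => by rw [pow_succ, Module.End.mul_apply, ih, he]
  obtain ⟨n, hn', hn1⟩ := (e.eventually_isCompl_ker_pow_range_pow.and
    (Filter.eventually_ge_atTop 1)).exists
  let Q : FGMod S := ⟨LinearMap.range (e ^ n)⟩
  let K : FGMod S := ⟨LinearMap.ker (e ^ n)⟩
  let i := (Submodule.prodEquivOfIsCompl _ _ hn').symm
  have hPQ : cl P = cl K + cl Q := cl_add_eq_iff.2 ⟨i⟩
  have hQ : Q.IsProj := Module.Projective.of_split (M := P.carrier)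
    (i.symm.toLinearMap ∘ₗ LinearMap.inr S K.carrier Q.carrier)
    (LinearMap.snd S K.carrier Q.carrier ∘ₗ i.toLinearMap) (by ext; simp)
  have hle := Nat.find_min' hne ⟨Q, f ∘ₗ (LinearMap.range (e ^ n)).subtype, hQ, fun m => by
    obtain ⟨p, rfl⟩ := hf m
    exact ⟨⟨(e ^ n) p, p, rfl⟩, hpow n p⟩, rfl⟩
  rw [← hn, hPQ, map_add] at hle
  have hK0 : LinearMap.ker (e ^ n) = ⊥ := Submodule.subsingleton_iff_eq_bot.1
    (cl_eq_zero_iff (M := K) |>.1 (len_eq_zero.1 (by omega)))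
  have hQ1 : LinearMap.range (e ^ n) = ⊤ := by
    have := hn'.sup_eq_top
    rwa [hK0, bot_sup_eq] at this
  obtain ⟨m, rfl⟩ := Nat.exists_eq_add_of_le' hn1
  rw [eq_top_iff, ← hQ1]
  rintro _ ⟨p, rfl⟩
  rw [pow_succ', Module.End.mul_apply]
  exact (h _).2

theorem isSyzygyOf_syz (M : FGMod S) : IsSyzygyOf (syz M) M := by
  have h : ∃ N, IsSyzygyOf N M := by
    obtain ⟨P, f, hf⟩ := exists_projective_cover M
    exact ⟨⟨LinearMap.ker f⟩, P, f, hf, ⟨LinearEquiv.refl _ _⟩⟩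
  rw [syz, dif_pos h]
  exact h.choose_spec

/-- A projection onto a projective module splits off. -/
theorem cl_eq_of_surjective {T P : FGMod S} (hP : P.IsProj) (g : T.carrier →ₗ[S] P.carrier)
    (hg : Surjective g) : cl T = cl P + cl ⟨LinearMap.ker g⟩ := by
  have : Module.Projective S P.carrier := hP
  obtain ⟨s, hs⟩ := Module.projective_lifting_property g LinearMap.id hg
  exact cl_add_eq_iff.2 ⟨splitEquiv s g fun x => LinearMap.congr_fun hs x⟩

/-- The kernel of the first projection of a fibre product. -/
def kerFstPullbackEquiv {P Q M : Type u} [AddCommGroup P] [Module S P] [AddCommGroup Q]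
    [Module S Q] [AddCommGroup M] [Module S M] (f : P →ₗ[S] M) (g : Q →ₗ[S] M)
    (T : Submodule S (P × Q)) (hT : ∀ x, x ∈ T ↔ f x.1 = g x.2) :
    LinearMap.ker (LinearMap.fst S P Q ∘ₗ T.subtype) ≃ₗ[S] LinearMap.ker g where
  toFun x := ⟨x.1.1.2, by
    have h0 : x.1.1.1 = 0 := x.2
    rw [LinearMap.mem_ker, ← (hT _).1 x.1.2, h0, map_zero]⟩
  map_add' _ _ := rfl
  map_smul' _ _ := rfl
  invFun y := ⟨⟨(0, y), (hT _).2 (by simp [LinearMap.mem_ker.1 y.2])⟩, rfl⟩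
  left_inv x := by
    have h0 : x.1.1.1 = 0 := x.2
    ext
    · exact h0.symm
    · rfl
  right_inv _ := rfl

/-- Half of Schanuel's lemma. -/
theorem toK0_pullback {P Q M : FGMod S} (hP : P.IsProj) (f : P.carrier →ₗ[S] M.carrier)
    (g : Q.carrier →ₗ[S] M.carrier) (hg : Surjective g)
    (T : Submodule S (P.carrier × Q.carrier)) (hT : ∀ x, x ∈ T ↔ f x.1 = g x.2) :
    toK0 (⟨T⟩ : FGMod S) = toK0 (⟨LinearMap.ker g⟩ : FGMod S) := by
  have h := cl_eq_of_surjective (T := ⟨T⟩) hP (LinearMap.fst S _ _ ∘ₗ T.subtype) fun p => by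
    obtain ⟨q, hq⟩ := hg (f p)
    exact ⟨⟨(p, q), (hT _).2 hq.symm⟩, rfl⟩
  rw [← k0_cl, h, map_add, k0_cl, toK0_of_isProj hP, zero_add]
  exact toK0_eq_of_equiv ⟨kerFstPullbackEquiv f g T hT⟩

/-- Schanuel's lemma in `K₀`. -/
theorem toK0_ker_eq {P Q M : FGMod S} (hP : P.IsProj) (hQ : Q.IsProj)
    (f : P.carrier →ₗ[S] M.carrier) (hf : Surjective f)
    (g : Q.carrier →ₗ[S] M.carrier) (hg : Surjective g) :
    toK0 (⟨LinearMap.ker f⟩ : FGMod S) = toK0 (⟨LinearMap.ker g⟩ : FGMod S) := by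
  let T : Submodule S (P.carrier × Q.carrier) :=
    LinearMap.eqLocus (f ∘ₗ LinearMap.fst S _ _) (g ∘ₗ LinearMap.snd S _ _)
  let T' : Submodule S (Q.carrier × P.carrier) :=
    LinearMap.eqLocus (g ∘ₗ LinearMap.fst S _ _) (f ∘ₗ LinearMap.snd S _ _)
  rw [← toK0_pullback hP f g hg T fun _ => Iff.rfl, ← toK0_pullback hQ g f hf T' fun _ => Iff.rfl]
  refine toK0_eq_of_equiv ⟨LinearEquiv.ofSubmodules (LinearEquiv.prodComm S _ _) T' T ?_⟩
  ext x
  rw [Submodule.mem_map_equiv]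
  exact eq_comm

theorem toK0_ker_eq_syz {P M : FGMod S} (hP : P.IsProj) (f : P.carrier →ₗ[S] M.carrier)
    (hf : Surjective f) : toK0 (⟨LinearMap.ker f⟩ : FGMod S) = toK0 (syz M) := by
  obtain ⟨Q, g, ⟨hQ, hg, -⟩, e⟩ := isSyzygyOf_syz M
  exact (toK0_ker_eq hP hQ f hf g hg).trans (toK0_eq_of_equiv e).symm

/-- The horseshoe lemma. -/
theorem ses_horseshoe {X Y Z : FGMod S} (h : SES X Y Z) :
    ∃ K : FGMod S, toK0 K = toK0 (syz Y) ∧ SES (syz X) K (syz Z) := by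
  obtain ⟨f, g, hf, hg, hfg⟩ := h
  obtain ⟨P, p, ⟨hP, hp, -⟩, eX⟩ := isSyzygyOf_syz X
  obtain ⟨Q, q, ⟨hQ, hq, -⟩, eZ⟩ := isSyzygyOf_syz Z
  have : Module.Projective S Q.carrier := hQ
  obtain ⟨l, hl⟩ := Module.projective_lifting_property g q hg
  have hl : ∀ x, g (l x) = q x := fun x => LinearMap.congr_fun hl x
  have hgf : ∀ x, g (f x) = 0 := fun x => by
    rw [← LinearMap.mem_ker, ← hfg]
    exact ⟨x, rfl⟩
  have hker : ∀ y, g y = 0 → ∃ a, f (p a) = y := fun y hy => by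
    rw [← LinearMap.mem_ker, ← hfg] at hy
    obtain ⟨x, rfl⟩ := hy
    obtain ⟨a, rfl⟩ := hp x
    exact ⟨a, rfl⟩
  let r : (prodMod P Q).carrier →ₗ[S] Y.carrier := (f ∘ₗ p).coprod l
  have hr : ∀ a b, r (a, b) = f (p a) + l b := fun a b => rfl
  have hrs : Surjective r := fun y => by
    obtain ⟨b, hb⟩ := hq (g y)
    obtain ⟨a, ha⟩ := hker (y - l b) (by rw [map_sub, hl, hb, sub_self])
    exact ⟨(a, b), by rw [hr, ha, sub_add_cancel]⟩
  refine ⟨⟨LinearMap.ker r⟩, toK0_ker_eq_syz (isProj_prodMod hP hQ) r hrs,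
    ses_congr (X := ⟨LinearMap.ker p⟩) (Y := ⟨LinearMap.ker r⟩) (Z := ⟨LinearMap.ker q⟩) ?_
      (cl_eq_iff.2 eX).symm rfl (cl_eq_iff.2 eZ).symm⟩
  have hq0 : ∀ x : LinearMap.ker r, x.1.2 ∈ LinearMap.ker q := fun x => by
    have h := congrArg g (LinearMap.mem_ker.1 x.2)
    rw [show x.1 = (x.1.1, x.1.2) from rfl, hr, map_add, hgf, hl, zero_add, map_zero] at h
    exact h
  refine ⟨((LinearMap.inl S P.carrier Q.carrier) ∘ₗ (LinearMap.ker p).subtype).codRestrict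
      (LinearMap.ker r) fun x => ?_,
    ((LinearMap.snd S P.carrier Q.carrier) ∘ₗ (LinearMap.ker r).subtype).codRestrict
      (LinearMap.ker q) hq0, ?_, ?_, ?_⟩
  · have hx : p x = 0 := x.2
    rw [LinearMap.mem_ker]
    exact (hr _ _).trans (by simp [hx])
  · intro x y hxy
    exact Subtype.ext (congrArg (fun z => z.1.1) hxy)
  · rintro ⟨b, hb⟩
    obtain ⟨a, ha⟩ := hker (l b) (by rw [hl]; exact hb)
    exact ⟨⟨(-a, b), LinearMap.mem_ker.2 ((hr _ _).trans
      (by rw [map_neg, map_neg, ha, neg_add_cancel]))⟩, rfl⟩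
  · ext x
    constructor
    · rintro ⟨y, rfl⟩
      rfl
    · intro hx
      have h2 : x.1.2 = 0 := congrArg Subtype.val hx
      have h1 : r (x.1.1, x.1.2) = 0 := x.2
      rw [hr, h2, map_zero, add_zero, ← map_zero f] at h1
      exact ⟨⟨x.1.1, hf h1⟩, Subtype.ext (Prod.ext rfl h2.symm)⟩

variable {L : AddMonoid.End (K0 S)}

theorem exists_ses_iterate_syz (hL : IsSyzEnd L) {X Y Z : FGMod S} (h : SES X Y Z) (n : ℕ) :
    ∃ X' Y' : FGMod S, toK0 X' = toK0 (syz^[n] X) ∧ toK0 Y' = toK0 (syz^[n] Y) ∧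
      SES X' Y' (syz^[n] Z) := by
  induction n with
  | zero => exact ⟨X, Y, rfl, rfl, h⟩
  | succ n ih =>
    obtain ⟨X', Y', hX, hY, h⟩ := ih
    obtain ⟨K, hK, h⟩ := ses_horseshoe h
    simp only [Function.iterate_succ_apply']
    exact ⟨syz X', K, by rw [← hL, ← hL, hX], by rw [hK, ← hL, ← hL, hY], h⟩

/-- The syzygies of the summands of `C` are controlled by the syzygies of `C`. -/
theorem map_grpOf_le (hL : IsSyzEnd L) (C : Set (FGMod S)) :
    (grpOf C).map L ≤ grpOf (insert (regular S) (syz '' C)) := by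
  have hreg : cl (regular S) ∈ sp (insert (regular S) (syz '' C)) := cl_mem_sp (Or.inl rfl)
  refine AddSubgroup.map_le_iff_le_comap.2 (grpOf_le_iff.2 fun M hM x y hxy => ?_)
  obtain ⟨X, rfl⟩ := exists_cl x
  obtain ⟨Y, rfl⟩ := exists_cl y
  have h : k0 (cl (syz X) + cl (syz Y)) = toK0 (syz M) := by
    rw [map_add, k0_cl, k0_cl, ← hL, ← hL, ← hL, ← k0_cl M, hxy, map_add k0, map_add L]
    rfl
  change L (toK0 X) ∈ grpOf _
  rw [hL, ← k0_cl]
  refine k0_mem_grpOf (mem_sp_of_add (y := cl (syz Y)) (mem_sp_of_k0_mem hreg ?_))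
  rw [h]
  exact k0_mem_grpOf (x := cl (syz M)) (cl_mem_sp (Or.inr ⟨M, hM, rfl⟩))

theorem classGrpD_syz_fg (hL : IsSyzEnd L) {C D : Set (FGMod S)} (hD : ∀ M ∈ D, syz M ∈ D)
    (h : (classGrpD D C).FG) : (classGrpD D (syz '' C)).FG := by
  obtain ⟨V, hV⟩ := classGrpD_fg_iff.1 h
  let W := prodMod (syz V) (regular S)
  have hW : cl (syz V) + cl (regular S) ∈ sp ({W} ∪ D) := cl_mem_sp (M := W) (Or.inl rfl)
  have hreg : cl (regular S) ∈ sp ({W} ∪ D) := mem_sp_of_add (add_comm (cl (syz V)) _ ▸ hW)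
  have hle : grpOf (insert (regular S) (syz '' ({V} ∪ D))) ≤ grpOf ({W} ∪ D) := by
    refine grpOf_le_grpOf ?_
    rintro _ (rfl | ⟨M, rfl | hM, rfl⟩)
    · exact hreg
    · exact mem_sp_of_add hW
    · exact cl_mem_sp (Or.inr (hD M hM))
  refine classGrpD_fg_iff.2 ⟨W, grpOf_le_grpOf ?_⟩
  rintro _ ⟨M, hM, rfl⟩
  refine mem_sp_of_k0_mem hreg (hle (map_grpOf_le hL _ ⟨toK0 M, hV ?_, hL M⟩))
  exact k0_mem_grpOf (x := cl M) (cl_mem_sp hM)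

theorem classGrpD_iterate_syz_fg (hL : IsSyzEnd L) {C D : Set (FGMod S)}
    (hD : ∀ M ∈ D, syz M ∈ D) {k : ℕ} (h : (classGrpD D ((fun M => syz^[k] M) '' C)).FG) (j : ℕ) :
    (classGrpD D ((fun M => syz^[k + j] M) '' C)).FG := by
  induction j with
  | zero => exact h
  | succ j ih =>
    have := classGrpD_syz_fg hL hD ih
    rw [Set.image_image] at this
    simpa only [← add_assoc, Function.iterate_succ_apply'] using this

theorem isLITClass_of_fg (hL : IsSyzEnd L) {C₁ C₂ D E : Set (FGMod S)} (hD : D = addOf D)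
    (hses : ∀ M ∈ E, ∃ X ∈ C₁, ∃ Y ∈ C₂, SES X Y M) {n : ℕ}
    (h₁ : (classGrpD D ((fun M => syz^[n] M) '' C₁)).FG)
    (h₂ : (classGrpD D ((fun M => syz^[n] M) '' C₂)).FG) :
    ∃ V : FGMod S, IsLITClass n V D E := by
  obtain ⟨V₁, hV₁⟩ := classGrpD_fg_iff.1 h₁
  obtain ⟨V₂, hV₂⟩ := classGrpD_fg_iff.1 h₂
  let V := prodMod (prodMod V₁ V₂) (regular S)
  have hV : cl V₁ + cl V₂ + cl (regular S) ∈ sp ({V} ∪ D) := cl_mem_sp (M := V) (Or.inl rfl)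
  have hreg : cl (regular S) ∈ sp ({V} ∪ D) := mem_sp_of_add (add_comm (cl V₁ + cl V₂) _ ▸ hV)
  have hle : ∀ U, cl U ∈ sp ({V} ∪ D) → grpOf ({U} ∪ D) ≤ grpOf ({V} ∪ D) := fun U hU => by
    refine grpOf_le_grpOf ?_
    rintro _ (rfl | hM)
    · exact hU
    · exact cl_mem_sp (Or.inr hM)
  have hle₁ := hV₁.trans (hle V₁ (mem_sp_of_add (mem_sp_of_add hV)))
  have hle₂ := hV₂.trans (hle V₂ (mem_sp_of_add (y := cl V₁)
    (add_comm (cl V₁) _ ▸ mem_sp_of_add hV)))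
  have key : ∀ X : FGMod S, toK0 X ∈ grpOf ({V} ∪ D) →
      ∃ V' D' : FGMod S, V' ∈ addOf {V} ∧ D' ∈ D ∧ cl X = cl (prodMod V' D') := fun X hX => by
    obtain ⟨v, hv, d, hd, h⟩ := exists_add_of_mem_sp_union (mem_sp_of_k0_mem (x := cl X) hreg hX)
    obtain ⟨V', rfl⟩ := exists_cl v
    obtain ⟨D', rfl⟩ := exists_cl d
    exact ⟨V', D', mem_addOf_iff.2 hv, hD ▸ mem_addOf_iff.2 hd, h⟩
  refine ⟨V, fun M hM => ?_⟩
  obtain ⟨X, hX, Y, hY, h⟩ := hses M hM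
  obtain ⟨X', Y', hX', hY', h⟩ := exists_ses_iterate_syz hL h n
  obtain ⟨V1, D1, hV1, hD1, e1⟩ := key X' <| hX' ▸ hle₁
    (k0_mem_grpOf (x := cl (syz^[n] X)) (cl_mem_sp ⟨X, hX, rfl⟩))
  obtain ⟨V0, D0, hV0, hD0, e0⟩ := key Y' <| hY' ▸ hle₂
    (k0_mem_grpOf (x := cl (syz^[n] Y)) (cl_mem_sp ⟨Y, hY, rfl⟩))
  exact ⟨V1, V0, D1, D0, hV1, hV0, hD1, hD0, ses_congr h e1 e0 rfl⟩

end Syzygies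

/-!
STATEMENT 7 (Proposition, part 1).  Let `D` be a `0`-Igusa-Todorov subcategory, and
`C₁, C₂, E` subcategories such that every `E ∈ E` sits in an exact sequence
`0 → C₁ → C₂ → E → 0` with `Cᵢ ∈ Cᵢ`.  If `C₁` and `C₂` are `D`-syzygy finite, then
`E` is `(n, V, D)`-LIT for some `n` and `V`; moreover one may take
`n = min {m | [Ωᵐ(C₁)]_D and [Ωᵐ(C₂)]_D are finitely generated}`.
-/
theorem stmt_7 (R A : Type u) [CommRing R] [IsArtinianRing R] [Ring A] [Algebra R A]
    [Module.Finite R A]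
    (L : AddMonoid.End (K0 Aᵐᵒᵖ)) (hL : IsSyzEnd L)
    (D : Set (FGMod Aᵐᵒᵖ)) (hD : IsZeroIT L D)
    (C1 C2 E : Set (FGMod Aᵐᵒᵖ))
    (hses : ∀ M ∈ E, ∃ X ∈ C1, ∃ Y ∈ C2, SES X Y M)
    (h1 : DSyzFinite D C1) (h2 : DSyzFinite D C2) :
    (∃ (n : ℕ) (V : FGMod Aᵐᵒᵖ), IsLITClass n V D E) ∧
      ∃ V : FGMod Aᵐᵒᵖ,
        IsLITClass
          (sInf {m : ℕ | (classGrpD D ((fun M => syz^[m] M) '' C1)).FG ∧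
            (classGrpD D ((fun M => syz^[m] M) '' C2)).FG})
          V D E := by
  have : IsArtinianRing Aᵐᵒᵖ := IsArtinianRing.of_finite R Aᵐᵒᵖ
  obtain ⟨hDadd, hDsyz, -⟩ := hD
  have hne : {m : ℕ | (classGrpD D ((fun M => syz^[m] M) '' C1)).FG ∧
      (classGrpD D ((fun M => syz^[m] M) '' C2)).FG}.Nonempty := by
    obtain ⟨k₁, h₁⟩ := h1
    obtain ⟨k₂, h₂⟩ := h2
    exact ⟨k₁ + k₂, classGrpD_iterate_syz_fg hL hDsyz h₁ k₂,
      add_comm k₂ k₁ ▸ classGrpD_iterate_syz_fg hL hDsyz h₂ k₁⟩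
  have hmin := Nat.sInf_mem hne
  have key := isLITClass_of_fg hL hDadd hses hmin.1 hmin.2
  exact ⟨⟨_, key⟩, key⟩

end LIT
end

section
/- Let A be an Artin algebra, D ⊆ mod A a 0-Igusa-Todorov subcategory, and C_1, C_2, E three subcategories of mod A such that for every E ∈ E there is an exact sequence 0 → C_1 → C_2 → E → 0 with C_i ∈ C_i for i = 1, 2. If C_1 is (n, V, D)-LIT and gldim(C_2) < ∞ (indeed gldim(C_2) ≤ n), then E is (n+1, V, D)-LIT with the same LIT module V. -/
/-!
Common framework for formalizing "On Lat-Igusa-Todorov algebras" (Barrios–Mata).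

For a ring `S`, `FGMod S` is the "category" of finitely generated (left) `S`-modules;
for an Artin algebra `A`, the category `mod A` of finitely generated *right*
`A`-modules is `FGMod Aᵐᵒᵖ`.
-/

universe u v

open Function

namespace LIT

open FGMod

variable {S : Type u} [Ring S]

section Modules

variable {V D Q W : Type*} [AddCommGroup V] [Module S V] [AddCommGroup D] [Module S D]
  [AddCommGroup Q] [Module S Q] [AddCommGroup W] [Module S W]

lemma isCompl_ker_range_of_bijective_comp (f : V →ₗ[S] W) (g : Q →ₗ[S] V)
    (h : Bijective (f ∘ₗ g)) : IsCompl (LinearMap.ker f) (LinearMap.range g) := by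
  constructor
  · rw [Submodule.disjoint_def]
    rintro _ hx ⟨y, rfl⟩
    have : y = 0 := h.1 (by simpa using hx)
    simp [this]
  · rw [codisjoint_iff, eq_top_iff]
    intro x _
    obtain ⟨y, hy⟩ := h.2 (f x)
    rw [Submodule.mem_sup]
    refine ⟨x - g y, ?_, g y, ⟨y, rfl⟩, by simp⟩
    simp only [LinearMap.coe_comp, comp_apply] at hy
    simp [hy]

/-- The product of two submodules, as a module. -/
def prodCoeEquiv (N : Submodule S V) (N' : Submodule S D) : N.prod N' ≃ₗ[S] N × N' where
  toFun x := (⟨x.1.1, x.2.1⟩, ⟨x.1.2, x.2.2⟩)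
  map_add' _ _ := rfl
  map_smul' _ _ := rfl
  invFun x := ⟨(x.1, x.2), x.1.2, x.2.2⟩

/-- The exchange property for projective modules of finite length. -/
lemma exists_ker_equiv_prod_of_projective [IsNoetherian S Q] [IsArtinian S Q]
    [Module.Projective S Q] (p : V × D →ₗ[S] Q) (hp : Surjective p) :
    ∃ (V' V'' : Submodule S V) (D' D'' : Submodule S D), IsCompl V' V'' ∧ IsCompl D' D'' ∧
      Nonempty (LinearMap.ker p ≃ₗ[S] V' × D') := by
  obtain ⟨s, hs⟩ := Module.projective_lifting_property p LinearMap.id hp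
  have hs' (y : Q) : p (s y) = y := LinearMap.congr_fun hs y
  let p₁ : V →ₗ[S] Q := p ∘ₗ LinearMap.inl S V D
  let p₂ : D →ₗ[S] Q := p ∘ₗ LinearMap.inr S V D
  let s₁ : Q →ₗ[S] V := LinearMap.fst S V D ∘ₗ s
  let s₂ : Q →ₗ[S] D := LinearMap.snd S V D ∘ₗ s
  let e : Module.End S Q := p₁ ∘ₗ s₁
  have hsum (y : Q) : p₂ (s₂ y) = y - e y := by
    have h : p₁ (s₁ y) + p₂ (s₂ y) = y := by
      conv_rhs => rw [← hs' y]
      simp only [p₁, p₂, s₁, s₂, LinearMap.comp_apply, ← map_add]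
      simp
    rw [eq_sub_iff_add_eq, add_comm]
    exact h
  obtain ⟨k, hk, hk1⟩ := (e.eventually_isCompl_ker_pow_range_pow.and
    (Filter.eventually_ge_atTop 1)).exists
  have hcomm (y : Q) : (e ^ k) (e y) = e ((e ^ k) y) := by
    rw [← Module.End.mul_apply, ← Module.End.mul_apply, (Commute.refl e).pow_left k]
  have hker {y : Q} (hy : e y = 0) : (e ^ k) y = 0 := by
    obtain ⟨j, rfl⟩ := Nat.exists_eq_add_of_le' hk1
    rw [pow_succ, Module.End.mul_apply, hy, map_zero]
  have hfix {y : Q} (hy : e y = y) : (e ^ k) y = y := by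
    rw [Module.End.coe_pow]
    exact Function.iterate_fixed hy k
  let Qa := LinearMap.range (e ^ k)
  let Qb := LinearMap.ker (e ^ k)
  have hdisj {y : Q} (ha : y ∈ Qa) (hb : y ∈ Qb) : y = 0 :=
    Submodule.disjoint_def.1 hk.disjoint y hb ha
  have hea {y : Q} (hy : y ∈ Qa) : e y ∈ Qa := by
    obtain ⟨z, rfl⟩ := hy
    exact ⟨e z, hcomm z⟩
  have heb {y : Q} (hy : y ∈ Qb) : e y ∈ Qb := by
    rw [LinearMap.mem_ker] at hy ⊢
    rw [hcomm, hy, map_zero]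
  let pa : Q →ₗ[S] Qa := Qa.projectionOnto Qb hk.symm
  let pb : Q →ₗ[S] Qb := Qb.projectionOnto Qa hk
  have hpa {y : Q} (hy : y ∈ Qa) : (pa y : Q) = y :=
    congrArg Subtype.val (Submodule.projectionOnto_apply_left hk.symm ⟨y, hy⟩)
  have hpb {y : Q} (hy : y ∈ Qb) : (pb y : Q) = y :=
    congrArg Subtype.val (Submodule.projectionOnto_apply_left hk ⟨y, hy⟩)
  have hpa0 {y : Q} (hy : pa y = 0) : y ∈ Qb :=
    (Submodule.projectionOnto_apply_eq_zero_iff hk.symm).1 hy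
  have hpb0 {y : Q} (hy : pb y = 0) : y ∈ Qa :=
    (Submodule.projectionOnto_apply_eq_zero_iff hk).1 hy
  have h₁ : Bijective ((pa ∘ₗ p₁) ∘ₗ (s₁ ∘ₗ Qa.subtype)) := by
    apply IsArtinian.bijective_of_injective_endomorphism
    rw [← LinearMap.ker_eq_bot, LinearMap.ker_eq_bot']
    rintro ⟨y, hy⟩ h
    have h' : pa (e y) = 0 := h
    have : e y = 0 := by rw [← hpa (hea hy), h', Submodule.coe_zero]
    exact Subtype.ext (hdisj hy (hker this))
  have h₂ : Bijective ((pb ∘ₗ p₂) ∘ₗ (s₂ ∘ₗ Qb.subtype)) := by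
    apply IsArtinian.bijective_of_injective_endomorphism
    rw [← LinearMap.ker_eq_bot, LinearMap.ker_eq_bot']
    rintro ⟨y, hy⟩ h
    have h' : pb (p₂ (s₂ y)) = 0 := h
    rw [hsum] at h'
    have : y - e y = 0 := by rw [← hpb (Qb.sub_mem hy (heb hy)), h', Submodule.coe_zero]
    have hyy := hfix (sub_eq_zero.1 this).symm
    exact Subtype.ext (hyy.symm.trans hy)
  let q : V × D →ₗ[S] Qa × Qb := (pa ∘ₗ p₁).prodMap (pb ∘ₗ p₂)
  let ε : (Qa × Qb) ≃ₗ[S] Q := Submodule.prodEquivOfIsCompl Qa Qb hk.symm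
  have hqs : Bijective (q ∘ₗ s) := by
    have : Bijective (ε.toLinearMap ∘ₗ (q ∘ₗ s)) := by
      apply IsArtinian.bijective_of_injective_endomorphism
      rw [LinearMap.coe_comp]
      refine ε.injective.comp ?_
      rw [← LinearMap.ker_eq_bot, LinearMap.ker_eq_bot']
      intro y h
      have ha : e y ∈ Qb := hpa0 (congrArg Prod.fst h)
      have hb : p₂ (s₂ y) ∈ Qa := hpb0 (congrArg Prod.snd h)
      rw [hsum] at hb
      obtain ⟨⟨ya, yb⟩, hy⟩ := ε.surjective y
      replace hy : (ya : Q) + yb = y := hy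
      have h0 : e (ya : Q) = 0 := by
        refine hdisj (hea ya.2) ?_
        rw [eq_sub_of_add_eq hy, map_sub]
        exact Qb.sub_mem ha (heb yb.2)
      have hya : (ya : Q) = 0 := hdisj ya.2 (hker h0)
      have hyb : y ∈ Qb := by
        rw [← hy, hya, zero_add]
        exact yb.2
      have hyy := hfix (sub_eq_zero.1 (hdisj hb (Qb.sub_mem hyb ha))).symm
      exact hyy.symm.trans hyb
    rw [LinearMap.coe_comp] at this
    exact (Bijective.of_comp_iff' ε.bijective _).1 this
  have hps : Bijective (p ∘ₗ s) := by
    rw [hs]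
    exact bijective_id
  have hc₁ := (isCompl_ker_range_of_bijective_comp p s hps).symm
  have hc₂ := (isCompl_ker_range_of_bijective_comp q s hqs).symm
  refine ⟨_, _, _, _, isCompl_ker_range_of_bijective_comp _ _ h₁,
    isCompl_ker_range_of_bijective_comp _ _ h₂,
    ⟨(Submodule.quotientEquivOfIsCompl _ _ hc₁).symm ≪≫ₗ
      Submodule.quotientEquivOfIsCompl _ _ hc₂ ≪≫ₗ
      LinearEquiv.ofEq _ _ (LinearMap.ker_prodMap _ _) ≪≫ₗ prodCoeEquiv _ _⟩⟩

end Modules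

namespace FGMod

lemma SES.of_equiv {X Y Z Z' : FGMod S} (h : SES X Y Z) (e : Z.carrier ≃ₗ[S] Z'.carrier) :
    SES X Y Z' := by
  obtain ⟨f, g, hf, hg, hfg⟩ := h
  refine ⟨f, e.toLinearMap ∘ₗ g, hf, e.surjective.comp hg, ?_⟩
  rw [hfg, LinearEquiv.ker_comp]

lemma SES.of_equiv_mid {X Y Y' Z : FGMod S} (h : SES X Y Z)
    (e : Y.carrier ≃ₗ[S] Y'.carrier) : SES X Y' Z := by
  obtain ⟨f, g, hf, hg, hfg⟩ := h
  refine ⟨e.toLinearMap ∘ₗ f, g ∘ₗ e.symm.toLinearMap, e.injective.comp hf,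
    hg.comp e.symm.surjective, ?_⟩
  rw [LinearMap.range_comp, hfg, LinearMap.ker_comp]
  exact Submodule.map_equiv_eq_comap_symm e _

lemma IsSummand.trans {N M K : FGMod S} (h : IsSummand N M) (h' : IsSummand M K) :
    IsSummand N K := by
  obtain ⟨N', ⟨e⟩⟩ := h
  obtain ⟨M', ⟨e'⟩⟩ := h'
  exact ⟨prodMod N' M', ⟨e' ≪≫ₗ (e.prodCongr (LinearEquiv.refl S M'.carrier)) ≪≫ₗ
    LinearEquiv.prodAssoc S N.carrier N'.carrier M'.carrier⟩⟩

lemma IsSummand.mem_addOf {N M : FGMod S} {C : Set (FGMod S)} (h : IsSummand N M)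
    (hM : M ∈ addOf C) : N ∈ addOf C := by
  obtain ⟨n, f, hf, hs⟩ := hM
  exact ⟨n, f, hf, h.trans hs⟩

variable [IsNoetherianRing S]

lemma isSummand_of_isCompl {M : FGMod S} {N N' : Submodule S M.carrier} (h : IsCompl N N') :
    IsSummand ⟨N⟩ M :=
  ⟨⟨N'⟩, ⟨(Submodule.prodEquivOfIsCompl N N' h).symm⟩⟩

lemma ses_ker {P M : FGMod S} (f : P.carrier →ₗ[S] M.carrier) (hf : Surjective f) :
    SES ⟨LinearMap.ker f⟩ P M :=
  ⟨(LinearMap.ker f).subtype, f, Subtype.val_injective, hf, Submodule.range_subtype _⟩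

/-- Pulling back a short exact sequence along a split inclusion. -/
lemma SES.ker_snd {X B N Q : FGMod S} (h : SES X B (prodMod N Q)) :
    ∃ p : B.carrier →ₗ[S] Q.carrier, Surjective p ∧ SES X ⟨LinearMap.ker p⟩ N := by
  obtain ⟨f, g, hf, hg, hfg⟩ := h
  have hfg0 (x) : g (f x) = 0 := by
    rw [← LinearMap.mem_ker, ← hfg]
    exact ⟨x, rfl⟩
  let p : B.carrier →ₗ[S] Q.carrier := LinearMap.snd S N.carrier Q.carrier ∘ₗ g
  refine ⟨p, Prod.snd_surjective.comp hg,
    f.codRestrict (LinearMap.ker p) (fun x => congrArg Prod.snd (hfg0 x)),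
    (LinearMap.fst S N.carrier Q.carrier ∘ₗ g) ∘ₗ (LinearMap.ker p).subtype, ?_, ?_, ?_⟩
  · intro x y hxy
    exact hf (congrArg Subtype.val hxy)
  · intro x
    obtain ⟨y, hy⟩ := hg (x, 0)
    exact ⟨⟨y, congrArg Prod.snd hy⟩, congrArg Prod.fst hy⟩
  · ext ⟨y, hy⟩
    constructor
    · rintro ⟨x, hx⟩
      have hx' : f x = y := congrArg Subtype.val hx
      subst hx'
      exact congrArg Prod.fst (hfg0 x)
    · intro hy'
      have : y ∈ LinearMap.ker g := Prod.ext hy' hy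
      rw [← hfg] at this
      obtain ⟨x, hx⟩ := this
      exact ⟨x, Subtype.ext hx⟩

/-- A surjection from a projective module differs from a projective cover by a projective
summand. -/
lemma IsProjCover.exists_ker_equiv {P W M : FGMod S} {f : P.carrier →ₗ[S] M.carrier}
    (hf : IsProjCover f) (hW : W.IsProj) (w : W.carrier →ₗ[S] M.carrier) (hw : Surjective w) :
    ∃ Q : FGMod S, Q.IsProj ∧
      Nonempty (LinearMap.ker w ≃ₗ[S] LinearMap.ker f × Q.carrier) := by
  obtain ⟨hP, hfs, hsup⟩ := hf
  have : Module.Projective S W.carrier := hW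
  have : Module.Projective S P.carrier := hP
  obtain ⟨g, hg⟩ := Module.projective_lifting_property f w hfs
  have hg' (x) : f (g x) = w x := LinearMap.congr_fun hg x
  have hgs : Surjective g := by
    rw [← LinearMap.range_eq_top]
    apply hsup
    rw [eq_top_iff]
    intro x _
    obtain ⟨y, hy⟩ := hw (f x)
    rw [Submodule.mem_sup]
    exact ⟨g y, ⟨y, rfl⟩, x - g y, by simp [hg', hy], by simp⟩
  obtain ⟨t, ht⟩ := Module.projective_lifting_property g LinearMap.id hgs
  have ht' (x) : g (t x) = x := LinearMap.congr_fun ht x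
  have htw (x) : w (t x) = f x := by rw [← hg', ht']
  refine ⟨⟨LinearMap.ker g⟩, ?_, ⟨?_⟩⟩
  · refine Module.Projective.of_split (LinearMap.ker g).subtype
      ((LinearMap.id - t ∘ₗ g).codRestrict (LinearMap.ker g) (fun x => by simp [ht'])) ?_
    ext ⟨x, hx⟩
    rw [LinearMap.mem_ker] at hx
    simp [hx]
  · exact
      { toFun := fun x => (⟨g x, by simp [hg']⟩, ⟨x - t (g x), by simp [ht']⟩)
        map_add' := fun x y => by
          ext <;> simp [map_add]
          abel
        map_smul' := fun c x => by
          ext <;> simp [map_smul, smul_sub]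
        invFun := fun y => ⟨t y.1 + y.2, by
          have h1 : f y.1 = 0 := y.1.2
          have h2 : g y.2 = 0 := y.2.2
          rw [LinearMap.mem_ker, map_add, htw, h1, ← hg', h2, map_zero, add_zero]⟩
        left_inv := fun x => by ext; simp
        right_inv := fun y => by
          have h2 : g y.2 = 0 := y.2.2
          ext <;> simp [ht', h2] }

/-- The horseshoe lemma, for given surjections onto the outer terms. -/
lemma SES.horseshoe {X W M P Q : FGMod S} (h : SES X W M)
    (f : P.carrier →ₗ[S] X.carrier) (hf : Surjective f)
    (g : Q.carrier →ₗ[S] M.carrier) (hg : Surjective g) (hQ : Q.IsProj) :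
    ∃ φ : P.carrier × Q.carrier →ₗ[S] W.carrier, Surjective φ ∧
      SES (S := S) ⟨LinearMap.ker f⟩ ⟨LinearMap.ker φ⟩ ⟨LinearMap.ker g⟩ := by
  obtain ⟨i, p, hi, hp, hip⟩ := h
  have : Module.Projective S Q.carrier := hQ
  have hip0 (x) : p (i x) = 0 := by
    rw [← LinearMap.mem_ker, ← hip]
    exact ⟨x, rfl⟩
  have hex {y} (hy : p y = 0) : ∃ a, i (f a) = y := by
    rw [← LinearMap.mem_ker, ← hip] at hy
    obtain ⟨x, rfl⟩ := hy
    obtain ⟨a, rfl⟩ := hf x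
    exact ⟨a, rfl⟩
  obtain ⟨l, hl⟩ := Module.projective_lifting_property p g hp
  have hl' (x) : p (l x) = g x := LinearMap.congr_fun hl x
  let φ : P.carrier × Q.carrier →ₗ[S] W.carrier := (i ∘ₗ f).coprod l
  have hφ (a b) : φ (a, b) = i (f a) + l b := by simp [φ]
  refine ⟨φ, ?_, ?_⟩
  · intro y
    obtain ⟨b, hb⟩ := hg (p y)
    obtain ⟨a, ha⟩ := hex (y := y - l b) (by simp [hl', hb])
    exact ⟨(a, b), by rw [hφ, ha]; simp⟩
  · refine ⟨(LinearMap.inl S P.carrier Q.carrier ∘ₗ (LinearMap.ker f).subtype).codRestrict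
        (LinearMap.ker φ) (fun x => ?_),
      (LinearMap.snd S P.carrier Q.carrier ∘ₗ (LinearMap.ker φ).subtype).codRestrict
        (LinearMap.ker g) (fun x => ?_), ?_, ?_, ?_⟩
    · have hx : f x = 0 := x.2
      exact (hφ x 0).trans (by simp [hx])
    · obtain ⟨⟨a, b⟩, hx⟩ := x
      rw [LinearMap.mem_ker, hφ] at hx
      have := congrArg p hx
      simpa [hip0, hl'] using this
    · intro x y hxy
      exact Subtype.ext (congrArg (fun z => z.1.1) hxy)
    · rintro ⟨b, hb⟩
      obtain ⟨a, ha⟩ := hex (y := l b) ((hl' b).trans hb)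
      refine ⟨⟨(-a, b), ?_⟩, rfl⟩
      rw [LinearMap.mem_ker, hφ, map_neg, map_neg, ha, neg_add_cancel]
    · ext ⟨⟨a, b⟩, hx⟩
      constructor
      · rintro ⟨x, hx'⟩
        exact Subtype.ext (congrArg (fun z => z.1.2) hx').symm
      · intro hb
        have hb' : b = 0 := congrArg Subtype.val hb
        subst hb'
        rw [LinearMap.mem_ker, hφ, map_zero, add_zero] at hx
        exact ⟨⟨a, hi (hx.trans (map_zero i).symm)⟩, rfl⟩

lemma exists_isProjCover [IsArtinianRing S] (M : FGMod S) :
    ∃ (P : FGMod S) (f : P.carrier →ₗ[S] M.carrier), IsProjCover f := by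
  obtain ⟨n, f, hf⟩ := Module.Finite.exists_fin' S M.carrier
  let T : Set (Submodule S (Fin n → S)) :=
    {Q | Module.Projective S Q ∧ Q.map f = ⊤}
  have hT : T.Nonempty := by
    refine ⟨⊤, Module.Projective.of_equiv Submodule.topEquiv.symm, ?_⟩
    rw [Submodule.map_top, LinearMap.range_eq_top.2 hf]
  obtain ⟨Q, ⟨hQ, hQf⟩, hmin⟩ := IsWellFounded.wf (r := (· < ·)).has_min T hT
  let fQ : Q →ₗ[S] M.carrier := f ∘ₗ Q.subtype
  have hfQ : Surjective fQ := by
    rw [← LinearMap.range_eq_top, LinearMap.range_comp, Submodule.range_subtype, hQf]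
  refine ⟨⟨Q⟩, fQ, hQ, hfQ, fun N hN => ?_⟩
  have hsN : Surjective (fQ ∘ₗ N.subtype) := by
    rw [← LinearMap.range_eq_top, LinearMap.range_comp, Submodule.range_subtype]
    have := congrArg (Submodule.map fQ) hN
    rwa [Submodule.map_sup, Submodule.map_top, LinearMap.range_eq_top.2 hfQ,
      (LinearMap.le_ker_iff_map).1 le_rfl, sup_bot_eq] at this
  obtain ⟨g, hg⟩ := Module.projective_lifting_property (fQ ∘ₗ N.subtype) fQ hsN
  let h : Module.End S Q := N.subtype ∘ₗ g
  have hfh (x) : fQ (h x) = fQ x := LinearMap.congr_fun hg x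
  have hfhk (k : ℕ) (x) : fQ ((h ^ k) x) = fQ x := by
    induction k with
    | zero => rfl
    | succ k ih => rw [pow_succ', Module.End.mul_apply, hfh, ih]
  obtain ⟨k, hk, hk1⟩ := (h.eventually_isCompl_ker_pow_range_pow.and
    (Filter.eventually_ge_atTop 1)).exists
  let K : Submodule S Q := LinearMap.range (h ^ k)
  have hKN : K ≤ N := by
    rintro _ ⟨x, rfl⟩
    obtain ⟨j, rfl⟩ := Nat.exists_eq_add_of_le' hk1
    rw [pow_succ', Module.End.mul_apply]
    exact (g _).2
  have hKT : K.map Q.subtype ∈ T := by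
    constructor
    · have : Module.Projective S K := by
        refine Module.Projective.of_split K.subtype (K.projectionOnto _ hk.symm) ?_
        ext x
        simp [K]
      exact Module.Projective.of_equiv
        (Submodule.equivMapOfInjective Q.subtype Subtype.val_injective K)
    · rw [← Submodule.map_comp, eq_top_iff]
      intro x _
      obtain ⟨y, rfl⟩ := hfQ x
      exact ⟨(h ^ k) y, ⟨y, rfl⟩, hfhk k y⟩
  have hle : K.map Q.subtype ≤ Q := Submodule.map_subtype_le Q K
  have heq : K.map Q.subtype = Q := by
    by_contra hne
    exact hmin _ hKT (lt_of_le_of_ne hle hne)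
  rw [eq_top_iff]
  intro x _
  apply hKN
  have hx : (x : Fin n → S) ∈ K.map Q.subtype := heq.ge x.2
  obtain ⟨y, hy, hyx⟩ := hx
  rwa [← Subtype.ext hyx]

variable [IsArtinianRing S]

lemma isSyzygyOf_syz (M : FGMod S) : IsSyzygyOf (syz M) M := by
  have h : ∃ N, IsSyzygyOf N M := by
    obtain ⟨P, f, hf⟩ := exists_isProjCover M
    exact ⟨⟨LinearMap.ker f⟩, P, f, hf, ⟨LinearEquiv.refl S _⟩⟩
  rw [syz, dif_pos h]
  exact h.choose_spec

end FGMod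

section ProjectiveDimension

open CategoryTheory

/-- The projective dimension of `M`, as an object of the category of all modules, is less
than `n`. -/
abbrev HasProjDimLT (M : FGMod S) (n : ℕ) : Prop :=
  HasProjectiveDimensionLT (ModuleCat.of S M.carrier) n

lemma FGMod.SES.exists_shortExact {X Y Z : FGMod S} (h : SES X Y Z) :
    ∃ T : ShortComplex (ModuleCat.{u} S), T.ShortExact ∧ T.X₁ = ModuleCat.of S X.carrier ∧
      T.X₂ = ModuleCat.of S Y.carrier ∧ T.X₃ = ModuleCat.of S Z.carrier := by
  obtain ⟨f, g, hf, hg, hfg⟩ := h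
  have h0 : g ∘ₗ f = 0 := LinearMap.range_le_ker_iff.1 hfg.le
  refine ⟨ShortComplex.moduleCatMk f g h0, ?_, rfl, rfl, rfl⟩
  exact
    { exact := by
        rw [ShortComplex.moduleCat_exact_iff_range_eq_ker]
        exact hfg
      mono_f := (ModuleCat.mono_iff_injective _).2 hf
      epi_g := (ModuleCat.epi_iff_surjective _).2 hg }

lemma hasProjDimLT_one_iff (M : FGMod S) : HasProjDimLT M 1 ↔ M.IsProj := by
  rw [HasProjDimLT, ← projective_iff_hasProjectiveDimensionLT_one,
    ← IsProjective.iff_projective]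
  rfl

variable [IsNoetherianRing S] [IsArtinianRing S]

lemma hasProjDimLT_of_isProj_iterate_syz (n : ℕ) (M : FGMod S) (h : (syz^[n] M).IsProj) :
    HasProjDimLT M (n + 1) := by
  induction n generalizing M with
  | zero => exact (hasProjDimLT_one_iff M).2 h
  | succ n ih =>
    have h1 := ih (syz M) h
    obtain ⟨P, f, hf, ⟨e⟩⟩ := isSyzygyOf_syz M
    obtain ⟨T, hT, hT1, hT2, hT3⟩ := (ses_ker f hf.2.1).exists_shortExact
    have hP : HasProjDimLT P 1 := (hasProjDimLT_one_iff P).2 hf.1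
    have hK : HasProjectiveDimensionLT T.X₁ (n + 1) := by
      rw [hT1]
      exact hasProjectiveDimensionLT_of_iso e.toModuleIso (n + 1)
    have := hT.hasProjectiveDimensionLT_X₃ (n + 1) hK
      (by rw [hT2]; exact hasProjectiveDimensionLT_of_ge _ 1 _ (by lia))
    rwa [hT3] at this

lemma hasProjDimLT_of_pdim_le {n : ℕ} {M : FGMod S} (h : pdim M ≤ n) :
    HasProjDimLT M (n + 1) := by
  have hlt : pdim M < ((n + 1 : ℕ) : ℕ∞) := h.trans_lt (by exact_mod_cast Nat.lt_succ_self n)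
  rw [pdim, sInf_lt_iff] at hlt
  obtain ⟨_, ⟨m, hm, rfl⟩, hmn⟩ := hlt
  have hmn' : m < n + 1 := by exact_mod_cast hmn
  have := hasProjDimLT_of_isProj_iterate_syz m M hm
  exact hasProjectiveDimensionLT_of_ge _ (m + 1) _ (by lia)

lemma FGMod.SES.exists_iterate_syz (n : ℕ) {X W M : FGMod S} (h : SES X W M)
    (hW : HasProjDimLT W (n + 1)) :
    ∃ W' : FGMod S, W'.IsProj ∧ SES (syz^[n] X) W' (syz^[n] M) := by
  induction n generalizing X W M with
  | zero => exact ⟨W, (hasProjDimLT_one_iff W).1 hW, h⟩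
  | succ n ih =>
    obtain ⟨P, f, hf, ⟨e⟩⟩ := isSyzygyOf_syz X
    obtain ⟨Q, g, hg, ⟨e'⟩⟩ := isSyzygyOf_syz M
    obtain ⟨φ, hφ, hs⟩ := h.horseshoe f hf.2.1 g hg.2.1 hg.1
    have hPQ : (prodMod P Q).IsProj := by
      have : Module.Projective S P.carrier := hf.1
      have : Module.Projective S Q.carrier := hg.1
      exact inferInstanceAs (Module.Projective S (P.carrier × Q.carrier))
    obtain ⟨T, hT, hT1, hT2, hT3⟩ := (ses_ker (P := prodMod P Q) φ hφ).exists_shortExact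
    have hPQ' := (hasProjDimLT_one_iff _).2 hPQ
    have hker := hT.hasProjectiveDimensionLT_X₁ (n + 1)
      (by rw [hT2]; exact hasProjectiveDimensionLT_of_ge _ 1 _ (by lia)) (by rwa [hT3])
    rw [hT1] at hker
    refine ih (W := ⟨LinearMap.ker φ⟩) ?_ hker
    obtain ⟨a, b, ha, hb, hab⟩ := hs.of_equiv (Z' := syz M) e'.symm
    refine ⟨a ∘ₗ e.toLinearMap, b, ha.comp e.injective, hb, ?_⟩
    rw [LinearMap.range_comp_of_range_eq_top _ e.range, hab]

end ProjectiveDimension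

/-!
STATEMENT 9 (Proposition, part 3).  With `C₁, C₂, E` as before (every `E ∈ E` sits in
an exact sequence `0 → C₁ → C₂ → E → 0`), if `C₁` is `(n, V, D)`-LIT and
`gldim(C₂) < ∞` (indeed `gldim(C₂) ≤ n`), then `E` is `(n+1, V, D)`-LIT with the same
LIT module `V`.
-/
theorem stmt_9 (R A : Type u) [CommRing R] [IsArtinianRing R] [Ring A] [Algebra R A]
    [Module.Finite R A]
    (L : AddMonoid.End (K0 Aᵐᵒᵖ)) (hL : IsSyzEnd L)
    (D : Set (FGMod Aᵐᵒᵖ)) (hD : IsZeroIT L D)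
    (C1 C2 E : Set (FGMod Aᵐᵒᵖ))
    (hses : ∀ M ∈ E, ∃ X ∈ C1, ∃ Y ∈ C2, SES X Y M)
    (n : ℕ) (V : FGMod Aᵐᵒᵖ)
    (h1 : IsLITClass n V D C1) (h2 : gldim C2 ≤ (n : ℕ∞)) :
    IsLITClass (n + 1) V D E := by
  have : IsArtinianRing Aᵐᵒᵖ := isArtinian_of_tower R inferInstance
  intro M hM
  obtain ⟨X, hX, Y, hY, hXYM⟩ := hses M hM
  obtain ⟨V1, V0, D1, D0, hV1, hV0, hD1, hD0, hres⟩ := h1 X hX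
  have hpd : pdim Y ≤ (n : ℕ∞) := (le_iSup₂ (f := fun M (_ : M ∈ C2) => pdim M) Y hY).trans h2
  obtain ⟨W, hW, f, g, hf, hg, hfg⟩ := hXYM.exists_iterate_syz n (hasProjDimLT_of_pdim_le hpd)
  obtain ⟨P, c, hc, ⟨e⟩⟩ := isSyzygyOf_syz (syz^[n] M)
  obtain ⟨Q, hQ, ⟨e'⟩⟩ := hc.exists_ker_equiv hW g hg
  have e₁ : (syz^[n] X).carrier ≃ₗ[Aᵐᵒᵖ] (syz (syz^[n] M)).carrier × Q.carrier :=
    LinearEquiv.ofInjective f hf ≪≫ₗ LinearEquiv.ofEq _ _ hfg ≪≫ₗ e' ≪≫ₗ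
      e.symm.prodCongr (LinearEquiv.refl _ _)
  obtain ⟨p, hp, hker⟩ := (hres.of_equiv (Z' := prodMod (syz (syz^[n] M)) Q) e₁).ker_snd
  have : Module.Projective Aᵐᵒᵖ Q.carrier := hQ
  obtain ⟨V', V'', D', D'', hV', hD', ⟨e₂⟩⟩ :=
    exists_ker_equiv_prod_of_projective (V := V0.carrier) (D := D0.carrier) p hp
  refine ⟨V1, ⟨V'⟩, D1, ⟨D'⟩, hV1, (isSummand_of_isCompl hV').mem_addOf hV0, hD1, ?_, ?_⟩
  · rw [hD.1] at hD0 ⊢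
    exact (isSummand_of_isCompl hD').mem_addOf hD0
  · rw [iterate_succ_apply']
    exact hker.of_equiv_mid (Y' := prodMod ⟨V'⟩ ⟨D'⟩) e₂
end LIT
end
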